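/- arXiv:1610.02562 — 11 statements merged into one kernel-verified Lean document; each statement's English description precedes it below -/
import Mathlib

section
/- Let r, α, β > 0 and let a = (a_n)_{n≥1} be a positive sequence such that ∑_{n=1}^∞ a_n^{β − 3α/2} converges. For t ≥ 1 set f_r^{(α,β)}(t) = ∑_{n=1}^∞ 2 a_n^{β − α/2} (a_n^α t² − r²) / (a_n^α t² + r²)². Then S_{3/2,1}^{(α,β)}(r, a) = (2/π) ∫₁^∞ [t / √(t² − 1)] f_r^{(α,β)}(t) dt. -/
open Real MeasureTheory

lemma hasDerivAt_sqrt_sq_sub_one {t : ℝ} (ht : 1 < t) :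
    HasDerivAt (fun t : ℝ => √(t ^ 2 - 1)) (t / √(t ^ 2 - 1)) t := by
  have h0 : 0 < t ^ 2 - 1 := by nlinarith
  refine (((hasDerivAt_pow 2 t).sub_const 1).sqrt h0.ne').congr_deriv ?_
  have := (Real.sqrt_pos.2 h0).ne'
  push_cast
  field_simp

lemma continuous_sqrt_sq_sub_one : Continuous fun t : ℝ => √(t ^ 2 - 1) := by
  fun_prop

lemma tendsto_sqrt_sq_sub_one_atTop :
    Filter.Tendsto (fun t : ℝ => √(t ^ 2 - 1)) Filter.atTop Filter.atTop :=
  Real.tendsto_sqrt_atTop.comp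
    (Filter.tendsto_atTop_add_const_right _ (-1) (Filter.tendsto_pow_atTop two_ne_zero))

lemma integrableOn_Ioi_div_sqrt_sq_sub_one :
    IntegrableOn (fun t : ℝ => t / √(t ^ 2 - 1) * (1 / t ^ 2)) (Set.Ioi 1) := by
  refine integrableOn_Ioi_deriv_of_nonneg (g := fun t => arctan √(t ^ 2 - 1)) (l := π / 2)
    (Real.continuous_arctan.comp continuous_sqrt_sq_sub_one).continuousWithinAt ?_ ?_ ?_
  · intro t ht
    have ht : (1 : ℝ) < t := ht
    convert (hasDerivAt_sqrt_sq_sub_one ht).arctan using 1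
    rw [Real.sq_sqrt (by nlinarith)]
    ring
  · intro t ht
    have ht : (1 : ℝ) < t := ht
    positivity
  · exact (Real.tendsto_arctan_atTop.mono_right nhdsWithin_le_nhds).comp
      tendsto_sqrt_sq_sub_one_atTop

lemma norm_mathieu_kernel_le {b r t : ℝ} (hb : 0 < b) (ht : 1 < t) :
    ‖t / √(t ^ 2 - 1) * ((b * t ^ 2 - r ^ 2) / (b * t ^ 2 + r ^ 2) ^ 2)‖ ≤
      b⁻¹ * (t / √(t ^ 2 - 1) * (1 / t ^ 2)) := by
  have ht0 : 0 < t := by linarith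
  have hbt : 0 < b * t ^ 2 := by positivity
  have hD : 0 < b * t ^ 2 + r ^ 2 := by positivity
  rw [norm_mul, Real.norm_of_nonneg (by positivity), mul_left_comm]
  refine mul_le_mul_of_nonneg_left ?_ (by positivity)
  rw [norm_div, Real.norm_eq_abs, Real.norm_of_nonneg (by positivity : 0 ≤ (b * t ^ 2 + r ^ 2) ^ 2)]
  calc |b * t ^ 2 - r ^ 2| / (b * t ^ 2 + r ^ 2) ^ 2
      ≤ (b * t ^ 2 + r ^ 2) / (b * t ^ 2 + r ^ 2) ^ 2 := by
        gcongr
        rw [abs_le]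
        constructor <;> nlinarith [sq_nonneg r]
    _ = 1 / (b * t ^ 2 + r ^ 2) := by field_simp
    _ ≤ 1 / (b * t ^ 2) := by
        gcongr
        nlinarith [sq_nonneg r]
    _ = b⁻¹ * (1 / t ^ 2) := by field_simp

lemma integrableOn_mathieu_kernel {b : ℝ} (r : ℝ) (hb : 0 < b) :
    IntegrableOn
      (fun t : ℝ => t / √(t ^ 2 - 1) * ((b * t ^ 2 - r ^ 2) / (b * t ^ 2 + r ^ 2) ^ 2))
      (Set.Ioi 1) := by
  refine Integrable.mono' (integrableOn_Ioi_div_sqrt_sq_sub_one.const_mul b⁻¹)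
    (Measurable.aestronglyMeasurable (by fun_prop)) ?_
  filter_upwards [ae_restrict_mem measurableSet_Ioi] with t ht
  exact norm_mathieu_kernel_le hb ht

lemma hasDerivAt_mathieu_primitive {s c : ℝ} (r : ℝ) (hs : 0 < s) (hc : 0 < c)
    (h : c ^ 2 = s ^ 2 + r ^ 2) (u : ℝ) :
    HasDerivAt
      (fun u => s / c ^ 3 * arctan (s / c * u) - r ^ 2 / c ^ 2 * (u / (s ^ 2 * u ^ 2 + c ^ 2)))
      ((s ^ 2 * (u ^ 2 + 1) - r ^ 2) / (s ^ 2 * (u ^ 2 + 1) + r ^ 2) ^ 2) u := by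
  have hD : s ^ 2 * u ^ 2 + c ^ 2 ≠ 0 := by positivity
  have hE : c ^ 2 + s ^ 2 * u ^ 2 ≠ 0 := by positivity
  have h1 := (((hasDerivAt_id u).const_mul (s / c)).arctan).const_mul (s / c ^ 3)
  have h2 := ((hasDerivAt_id u).div
    (((hasDerivAt_pow 2 u).const_mul (s ^ 2)).add_const (c ^ 2)) hD).const_mul (r ^ 2 / c ^ 2)
  refine (h1.sub h2).congr_deriv ?_
  have e : s ^ 2 * (u ^ 2 + 1) + r ^ 2 = s ^ 2 * u ^ 2 + c ^ 2 := by rw [h]; ring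
  have e' : 1 + (s / c * u) ^ 2 = (s ^ 2 * u ^ 2 + c ^ 2) / c ^ 2 := by field_simp; ring
  have er : r ^ 2 = c ^ 2 - s ^ 2 := by linarith
  simp only [id, mul_one, one_mul, e, e']
  rw [er]
  field_simp
  push_cast
  ring

lemma integral_mathieu_kernel {s c : ℝ} (r : ℝ) (hs : 0 < s) (hc : 0 < c)
    (h : c ^ 2 = s ^ 2 + r ^ 2) :
    ∫ t in Set.Ioi (1 : ℝ),
      t / √(t ^ 2 - 1) * ((s ^ 2 * t ^ 2 - r ^ 2) / (s ^ 2 * t ^ 2 + r ^ 2) ^ 2) =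
      π / 2 * (s / c ^ 3) := by
  set G : ℝ → ℝ := fun u =>
    s / c ^ 3 * arctan (s / c * u) - r ^ 2 / c ^ 2 * (u / (s ^ 2 * u ^ 2 + c ^ 2)) with hG
  have hd := hasDerivAt_mathieu_primitive r hs hc h
  have hGc : Continuous G := continuous_iff_continuousAt.2 fun u => (hd u).continuousAt
  have hlim : Filter.Tendsto G Filter.atTop (nhds (π / 2 * (s / c ^ 3))) := by
    have h1 : Filter.Tendsto (fun u => arctan (s / c * u)) Filter.atTop (nhds (π / 2)) :=
      (Real.tendsto_arctan_atTop.mono_right nhdsWithin_le_nhds).comp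
        (Filter.tendsto_id.const_mul_atTop (by positivity))
    have h2 : Filter.Tendsto (fun u : ℝ => u / (s ^ 2 * u ^ 2 + c ^ 2)) Filter.atTop (nhds 0) := by
      refine squeeze_zero' (g := fun u : ℝ => (s ^ 2)⁻¹ * u⁻¹) ?_ ?_ ?_
      · filter_upwards [Filter.eventually_gt_atTop 0] with u hu
        positivity
      · filter_upwards [Filter.eventually_gt_atTop 0] with u hu
        calc u / (s ^ 2 * u ^ 2 + c ^ 2) ≤ u / (s ^ 2 * u ^ 2) := by
              gcongr
              nlinarith [sq_nonneg c]
          _ = (s ^ 2)⁻¹ * u⁻¹ := by field_simp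
      · simpa using tendsto_inv_atTop_zero.const_mul (s ^ 2)⁻¹
    simpa [hG, mul_comm] using (h1.const_mul (s / c ^ 3)).sub (h2.const_mul (r ^ 2 / c ^ 2))
  have key := integral_Ioi_of_hasDerivAt_of_tendsto (f := fun t => G √(t ^ 2 - 1))
    (hGc.comp continuous_sqrt_sq_sub_one).continuousWithinAt (fun t ht => ?_)
    (integrableOn_mathieu_kernel r (by positivity : 0 < s ^ 2))
    (hlim.comp tendsto_sqrt_sq_sub_one_atTop)
  · rw [key]
    simp [hG]
  · have ht : (1 : ℝ) < t := ht
    refine ((hd √(t ^ 2 - 1)).comp t (hasDerivAt_sqrt_sq_sub_one ht)).congr_deriv ?_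
    rw [Real.sq_sqrt (by nlinarith), sub_add_cancel, mul_comm]

/-- Integral expression for the Mathieu-type series
`S_{3/2,1}^{(α,β)}(r, a) = ∑_{n≥1} 2 a_n^β / (a_n^α + r²)^{3/2}` via the Fourier transform:
`S_{3/2,1}^{(α,β)}(r, a) = (2/π) ∫₁^∞ (t/√(t²-1)) f_r^{(α,β)}(t) dt`, where
`f_r^{(α,β)}(t) = ∑_{n≥1} 2 a_n^{β-α/2} (a_n^α t² - r²)/(a_n^α t² + r²)²`. -/
theorem mathieu_integral_repr_fourier
    (r α β : ℝ) (a : ℕ+ → ℝ)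
    (hr : 0 < r) (hα : 0 < α) (hβ : 0 < β) (ha : ∀ n, 0 < a n)
    (hsum : Summable fun n : ℕ+ => (a n) ^ (β - 3 * α / 2)) :
    (∑' n : ℕ+, 2 * (a n) ^ β / ((a n) ^ α + r ^ 2) ^ ((3 : ℝ) / 2)) =
      (2 / π) *
        ∫ t in Set.Ioi (1 : ℝ),
          (t / Real.sqrt (t ^ 2 - 1)) *
            ∑' n : ℕ+, 2 * (a n) ^ (β - α / 2) * ((a n) ^ α * t ^ 2 - r ^ 2) /
              ((a n) ^ α * t ^ 2 + r ^ 2) ^ 2 := by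
  set w : ℕ+ → ℝ := fun n => 2 * (a n) ^ (β - α / 2) with hw
  set k : ℕ+ → ℝ → ℝ := fun n t =>
    t / √(t ^ 2 - 1) * (((a n) ^ α * t ^ 2 - r ^ 2) / ((a n) ^ α * t ^ 2 + r ^ 2) ^ 2) with hk
  have hb : ∀ n, 0 < (a n) ^ α := fun n => Real.rpow_pos_of_pos (ha n) _
  have hw0 : ∀ n, 0 < w n := fun n => mul_pos two_pos (Real.rpow_pos_of_pos (ha n) _)
  have hwk : ∀ n, IntegrableOn (fun t => w n * k n t) (Set.Ioi 1) := fun n =>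
    (integrableOn_mathieu_kernel r (hb n)).const_mul _
  set K := ∫ t in Set.Ioi (1 : ℝ), t / √(t ^ 2 - 1) * (1 / t ^ 2)
  have hnorm : Summable fun n => ∫ t in Set.Ioi (1 : ℝ), ‖w n * k n t‖ := by
    refine Summable.of_nonneg_of_le (fun n => integral_nonneg fun t => norm_nonneg _) (fun n => ?_)
      (hsum.mul_left (2 * K))
    have hwb : w n * ((a n) ^ α)⁻¹ = 2 * (a n) ^ (β - 3 * α / 2) := by
      rw [hw, ← Real.rpow_neg (ha n).le, mul_assoc, ← Real.rpow_add (ha n)]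
      ring_nf
    calc ∫ t in Set.Ioi (1 : ℝ), ‖w n * k n t‖
        ≤ ∫ t in Set.Ioi (1 : ℝ),
            2 * (a n) ^ (β - 3 * α / 2) * (t / √(t ^ 2 - 1) * (1 / t ^ 2)) := by
          refine setIntegral_mono_on (hwk n).norm
            (integrableOn_Ioi_div_sqrt_sq_sub_one.const_mul _) measurableSet_Ioi fun t ht => ?_
          rw [norm_mul, Real.norm_of_nonneg (hw0 n).le, ← hwb, mul_assoc (w n)]
          exact mul_le_mul_of_nonneg_left (norm_mathieu_kernel_le (hb n) ht) (hw0 n).le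
      _ = 2 * K * (a n) ^ (β - 3 * α / 2) := by
          rw [integral_const_mul]
          ring
  have hs := (hasSum_integral_of_summable_integral_norm hwk hnorm).tsum_eq
  have hfun : ∀ t : ℝ, (t / √(t ^ 2 - 1)) *
      ∑' n : ℕ+, 2 * (a n) ^ (β - α / 2) * ((a n) ^ α * t ^ 2 - r ^ 2) /
        ((a n) ^ α * t ^ 2 + r ^ 2) ^ 2 = ∑' n, w n * k n t := by
    intro t
    rw [← tsum_mul_left]
    refine tsum_congr fun n => ?_
    simp only [hw, hk]
    ring
  simp only [hfun]
  rw [← hs, ← tsum_mul_left]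
  refine tsum_congr fun n => ?_
  have hA : 0 < (a n) ^ α + r ^ 2 := add_pos (hb n) (by positivity)
  have hk_int := integral_mathieu_kernel (s := (a n) ^ (α / 2)) (c := √((a n) ^ α + r ^ 2)) r
    (Real.rpow_pos_of_pos (ha n) _) (Real.sqrt_pos.2 hA)
  have hsq : ((a n) ^ (α / 2)) ^ 2 = (a n) ^ α := by
    rw [← Real.rpow_mul_natCast (ha n).le]
    norm_num
  rw [hsq, Real.sq_sqrt hA.le] at hk_int
  have hc3 : √((a n) ^ α + r ^ 2) ^ 3 = ((a n) ^ α + r ^ 2) ^ ((3 : ℝ) / 2) := by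
    rw [Real.sqrt_eq_rpow, ← Real.rpow_mul_natCast hA.le]
    norm_num
  have hab : (a n) ^ β = (a n) ^ (β - α / 2) * (a n) ^ (α / 2) := by
    rw [← Real.rpow_add (ha n), sub_add_cancel]
  rw [integral_const_mul, hk_int rfl, hc3, hab]
  have hpi := Real.pi_ne_zero
  simp only [hw]
  field_simp
end

section
/- Let r, α, μ, ν > 0 satisfy α(μ − 1) > ν + 2. Then the Turán-type inequality S_{μ,ν}^{(α,α+2)}(r) · S_{μ,ν}^{(α,α)}(r) ≥ (S_{μ,ν}^{(α,α+1)}(r))² holds. -/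
open Real

/-- Cauchy–Schwarz for infinite sums of real numbers. -/
theorem sq_tsum_le_tsum_mul_tsum_of_sq_le_mul {ι : Type*} {f g h : ι → ℝ}
    (hf : Summable f) (hg : Summable g) (hh : Summable h)
    (hf0 : ∀ i, 0 ≤ f i) (hh0 : ∀ i, 0 ≤ h i) (hgfh : ∀ i, g i ^ 2 ≤ f i * h i) :
    (∑' i, g i) ^ 2 ≤ (∑' i, f i) * ∑' i, h i := by
  have key : ∀ x : ℝ,
      0 ≤ (∑' i, f i) * (x * x) + (2 * ∑' i, g i) * x + ∑' i, h i := by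
    intro x
    have e : (∑' i, f i) * (x * x) + (2 * ∑' i, g i) * x + ∑' i, h i
        = ∑' i, (f i * (x * x) + (2 * g i) * x + h i) := by
      rw [((hf.mul_right _).add ((hg.mul_left 2).mul_right x)).tsum_add hh,
        (hf.mul_right _).tsum_add ((hg.mul_left 2).mul_right x),
        tsum_mul_right, tsum_mul_right, tsum_mul_left]
    rw [e]
    refine tsum_nonneg fun i => ?_
    have h1 := hgfh i
    rcases (hf0 i).eq_or_lt with h0 | h0
    · have hgi : g i = 0 := by
        rw [← h0, zero_mul] at h1
        exact pow_eq_zero_iff two_ne_zero |>.1 (le_antisymm h1 (sq_nonneg _))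
      simp [← h0, hgi, hh0 i]
    · refine nonneg_of_mul_nonneg_right ?_ h0
      nlinarith [sq_nonneg (f i * x + g i)]
  have := discrim_le_zero key
  unfold discrim at this
  linarith

theorem ascPochhammer_eval_eq_prod {R : Type*} [CommSemiring R] (n : ℕ) (x : R) :
    (ascPochhammer R n).eval x = ∏ j ∈ Finset.range n, (x + j) := by
  induction n with
  | zero => simp
  | succ n ih => rw [ascPochhammer_succ_eval, ih, Finset.prod_range_succ]

/-- The Gauss product for `Γ`, written in terms of the rising factorial. -/
theorem ascPochhammer_eval_div_factorial_mul_GammaSeq {ν : ℝ} (hν : 0 < ν) (n : ℕ) :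
    (ascPochhammer ℝ n).eval ν / (n.factorial : ℝ) * Real.GammaSeq ν n
      = (n : ℝ) ^ ν / (ν + n) := by
  have hp := ascPochhammer_pos n ν hν
  have hn : (n.factorial : ℝ) ≠ 0 := by positivity
  have hs : ν + n ≠ 0 := by positivity
  rw [Real.GammaSeq, Finset.prod_range_succ, ← ascPochhammer_eval_eq_prod]
  field_simp

/-- `(ν)ₙ / n! = O(n ^ (ν - 1))`. -/
theorem ascPochhammer_eval_div_factorial_isBigO {ν : ℝ} (hν : 0 < ν) :
    (fun n : ℕ => (ascPochhammer ℝ n).eval ν / (n.factorial : ℝ))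
      =O[Filter.atTop] fun n : ℕ => (n : ℝ) ^ (ν - 1) := by
  have hG := Real.Gamma_pos_of_pos hν
  refine Asymptotics.IsBigO.of_bound (2 / Real.Gamma ν) ?_
  filter_upwards [(Real.GammaSeq_tendsto_Gamma ν).eventually
    (lt_mem_nhds (half_lt_self hG)), Filter.eventually_gt_atTop 0] with n hn hn0
  have hn0' : (0 : ℝ) < n := by exact_mod_cast hn0
  have hp : 0 ≤ (ascPochhammer ℝ n).eval ν / (n.factorial : ℝ) :=
    div_nonneg (ascPochhammer_pos n ν hν).le (by positivity)
  rw [Real.norm_of_nonneg hp, Real.norm_of_nonneg (by positivity), div_mul_eq_mul_div,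
    le_div_iff₀ hG]
  have h1 : (n : ℝ) ^ ν / (ν + n) ≤ (n : ℝ) ^ (ν - 1) := by
    rw [Real.rpow_sub_one hn0'.ne']
    gcongr
    linarith
  have h2 := mul_le_mul_of_nonneg_left hn.le hp
  rw [ascPochhammer_eval_div_factorial_mul_GammaSeq hν] at h2
  linarith

/-- Convergence of the generalized Mathieu-type series with exponent `β`. -/
theorem summable_mathieu {r α β μ ν : ℝ} (hμ : 0 < μ) (hν : 0 < ν)
    (hconv : ν + β < α * μ) :
    Summable fun n : ℕ+ => 2 * (n : ℝ) ^ β * (ascPochhammer ℝ (n : ℕ)).eval ν /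
      (((n : ℝ) ^ α + r ^ 2) ^ μ * ((n : ℕ).factorial : ℝ)) := by
  suffices h : Summable fun n : ℕ => 2 * (n : ℝ) ^ β * (ascPochhammer ℝ n).eval ν /
      (((n : ℝ) ^ α + r ^ 2) ^ μ * (n.factorial : ℝ)) from
    h.comp_injective PNat.coe_injective
  have hs : Summable fun n : ℕ => (n : ℝ) ^ (β - α * μ + (ν - 1)) :=
    Real.summable_nat_rpow.2 (by linarith)
  refine summable_of_isBigO_nat hs ?_
  have h1 : (fun n : ℕ => 2 * (n : ℝ) ^ β / ((n : ℝ) ^ α + r ^ 2) ^ μ)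
      =O[Filter.atTop] fun n : ℕ => (n : ℝ) ^ (β - α * μ) := by
    refine Asymptotics.IsBigO.of_bound 2 ?_
    filter_upwards [Filter.eventually_gt_atTop 0] with n hn
    have hn' : (0 : ℝ) < n := by exact_mod_cast hn
    rw [Real.norm_of_nonneg (by positivity), Real.norm_of_nonneg (by positivity),
      Real.rpow_sub hn', Real.rpow_mul hn'.le, mul_div_assoc]
    gcongr
    exact le_add_of_nonneg_right (sq_nonneg r)
  refine (h1.mul (ascPochhammer_eval_div_factorial_isBigO hν)).congr' ?_ ?_
  · exact Filter.Eventually.of_forall fun n => div_mul_div_comm _ _ _ _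
  · filter_upwards [Filter.eventually_gt_atTop 0] with n hn
    rw [← Real.rpow_add (by exact_mod_cast hn)]

/-- Turán-type inequality for the generalized Mathieu-type series:
`S_{μ,ν}^{(α,α+2)}(r) · S_{μ,ν}^{(α,α)}(r) ≥ (S_{μ,ν}^{(α,α+1)}(r))²`, where
`S_{μ,ν}^{(α,β)}(r) = ∑_{n≥1} 2 n^β (ν)_n / ((n^α + r²)^μ n!)`. -/
theorem mathieu_turan_inequality
    (r α μ ν : ℝ) (hr : 0 < r) (hα : 0 < α) (hμ : 0 < μ) (hν : 0 < ν)
    (hconv : ν + 2 < α * (μ - 1)) :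
    (∑' n : ℕ+, 2 * (n : ℝ) ^ (α + 2) * (ascPochhammer ℝ (n : ℕ)).eval ν /
          (((n : ℝ) ^ α + r ^ 2) ^ μ * ((n : ℕ).factorial : ℝ))) *
        (∑' n : ℕ+, 2 * (n : ℝ) ^ α * (ascPochhammer ℝ (n : ℕ)).eval ν /
          (((n : ℝ) ^ α + r ^ 2) ^ μ * ((n : ℕ).factorial : ℝ))) ≥
      (∑' n : ℕ+, 2 * (n : ℝ) ^ (α + 1) * (ascPochhammer ℝ (n : ℕ)).eval ν /
          (((n : ℝ) ^ α + r ^ 2) ^ μ * ((n : ℕ).factorial : ℝ))) ^ 2 := by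
  have hnn : ∀ (β : ℝ) (n : ℕ+), 0 ≤ 2 * (n : ℝ) ^ β * (ascPochhammer ℝ (n : ℕ)).eval ν /
      (((n : ℝ) ^ α + r ^ 2) ^ μ * ((n : ℕ).factorial : ℝ)) := fun β n => by
    have := ascPochhammer_pos (n : ℕ) ν hν
    positivity
  refine sq_tsum_le_tsum_mul_tsum_of_sq_le_mul (summable_mathieu hμ hν (by linarith))
    (summable_mathieu hμ hν (by linarith)) (summable_mathieu hμ hν (by linarith))
    (hnn _) (hnn _) fun n => le_of_eq ?_
  have hn : (0 : ℝ) < n := by exact_mod_cast n.pos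
  rw [Real.rpow_add hn, Real.rpow_add hn, Real.rpow_one, Real.rpow_two]
  ring
end

section
/- Let r > 0, μ > 0 and 0 < ν < 2μ + 1, and let t be a real number. Then ∑_{n=1}^∞ e^{int} · 2n (ν)_n / ((n² + r²)^{μ+1} n!) = (√π / ((2r)^{μ−1/2} Γ(μ+1))) ∫₀^∞ u^{μ+1/2} [(1 − e^{it−u})^{−ν} − 1] J_{μ−1/2}(ru) du, where the complex power is the principal branch; consequently the characteristic function of the random variable X with P(X = n) = [2n(ν)_n/((n²+r²)^{μ+1} n!)] / S_{μ+1,ν}^{(2,1)}(r) equals this integral divided by S_{μ+1,ν}^{(2,1)}(r). -/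
open Real MeasureTheory

/-- Bessel function of the first kind, `J_p(x) = ∑_{m≥0} (-1)^m (x/2)^{2m+p} / (m! Γ(m+p+1))`. -/
noncomputable def besselJ (p x : ℝ) : ℝ :=
  ∑' m : ℕ, (-1 : ℝ) ^ m * (x / 2) ^ (2 * (m : ℝ) + p) /
    ((m.factorial : ℝ) * Real.Gamma ((m : ℝ) + p + 1))

open Set Filter Topology

lemma hasSum_ascPochhammer_mul_pow (a : ℝ) {w : ℂ} (hw : ‖w‖ < 1) :
    HasSum (fun n : ℕ ↦ (((ascPochhammer ℝ n).eval a / (n.factorial : ℝ) : ℝ) : ℂ) * w ^ n)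
      ((1 - w) ^ (-(a : ℂ))) := by
  have hcoef (n : ℕ) : Ring.choose ((a : ℂ) + n - 1) n =
      (((ascPochhammer ℝ n).eval a / (n.factorial : ℝ) : ℝ) : ℂ) := by
    have h := Ring.factorial_nsmul_multichoose_eq_ascPochhammer a n
    rw [Polynomial.ascPochhammer_smeval_eq_eval, Ring.multichoose_eq, nsmul_eq_mul] at h
    have h' : Ring.choose ((a : ℂ) + n - 1) n = ((Ring.choose (a + n - 1) n : ℝ) : ℂ) := by
      rw [Complex.ofReal_choose]; push_cast; rfl
    rw [h', ← h, mul_div_cancel_left₀ _ (by positivity)]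
  have h := (Complex.one_div_one_sub_cpow_hasFPowerSeriesOnBall_zero a).hasSum (y := w)
    (by
      rw [Metric.mem_eball, edist_zero_right, ← ofReal_norm, ENNReal.ofReal_lt_one]
      exact hw)
  simpa [FormalMultilinearSeries.ofScalars_apply_eq, hcoef, Complex.cpow_neg, mul_comm] using h

lemma summable_ascPochhammer_mul_rpow_neg {a b : ℝ} (ha : 0 < a) (hab : a < b) :
    Summable (fun n : ℕ ↦
      (ascPochhammer ℝ n).eval a / (n.factorial : ℝ) * (n : ℝ) ^ (-b)) := by
  refine summable_of_isBigO_nat (g := fun n : ℕ ↦ (n : ℝ) ^ (a - 1 - b))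
    (Real.summable_nat_rpow.2 (by linarith)) ?_
  have hlim : Tendsto (fun n ↦ (Real.GammaSeq a n)⁻¹) atTop (𝓝 (Real.Gamma a)⁻¹) :=
    (Real.GammaSeq_tendsto_Gamma a).inv₀ (Real.Gamma_pos_of_pos ha).ne'
  have hO := (hlim.isBigO_one ℝ).mul (Asymptotics.isBigO_refl (fun n : ℕ ↦ (n : ℝ) ^ (a - 1 - b)) atTop)
  simp only [one_mul] at hO
  refine Asymptotics.IsBigO.trans (Asymptotics.IsBigO.of_bound 1 ?_) hO
  filter_upwards [eventually_gt_atTop 0] with n hn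
  have hn' : (0 : ℝ) < n := by exact_mod_cast hn
  have hprod : ∏ j ∈ Finset.range (n + 1), (a + j) = (ascPochhammer ℝ n).eval a * (a + n) := by
    rw [← ascPochhammer_succ_eval]
    generalize n + 1 = k
    induction k with
    | zero => simp
    | succ k ih => rw [Finset.prod_range_succ, ih, ascPochhammer_succ_eval]
  have hP : 0 < (ascPochhammer ℝ n).eval a := ascPochhammer_pos n a ha
  have key : (ascPochhammer ℝ n).eval a / (n.factorial : ℝ) * (n : ℝ) ^ (-b) =
      (Real.GammaSeq a n)⁻¹ * (n : ℝ) ^ (a - 1 - b) * (n / (a + n)) := by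
    rw [Real.GammaSeq, hprod, sub_sub, Real.rpow_sub hn', Real.rpow_add hn', Real.rpow_one,
      Real.rpow_neg hn'.le]
    have : 0 < (n : ℝ) ^ a := by positivity
    have : 0 < (n : ℝ) ^ b := by positivity
    field_simp
  rw [key, norm_mul, one_mul]
  refine mul_le_of_le_one_right (norm_nonneg _) ?_
  rw [Real.norm_of_nonneg (by positivity), div_le_one (by positivity)]
  linarith

lemma integrableOn_and_integral_beta {a b : ℝ} (ha : 0 < a) (hb : 0 < b) :
    IntegrableOn (fun v : ℝ ↦ v ^ (a - 1) * (1 - v) ^ (b - 1)) (Ioc 0 1) ∧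
      ∫ v in Ioc (0 : ℝ) 1, v ^ (a - 1) * (1 - v) ^ (b - 1) =
        Real.Gamma a * Real.Gamma b / Real.Gamma (a + b) := by
  have hcongr : EqOn (fun v : ℝ ↦ (v : ℂ) ^ ((a : ℂ) - 1) * (1 - (v : ℂ)) ^ ((b : ℂ) - 1))
      (fun v : ℝ ↦ ((v ^ (a - 1) * (1 - v) ^ (b - 1) : ℝ) : ℂ)) (Ioc 0 1) := by
    intro v hv
    have h1 : (0 : ℝ) ≤ 1 - v := by linarith [hv.2]
    simp only [Complex.ofReal_mul, Complex.ofReal_cpow hv.1.le, Complex.ofReal_cpow h1]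
    push_cast
    rfl
  have hint := (Complex.betaIntegral_convergent (u := a) (v := b) (by simpa) (by simpa))
  rw [intervalIntegrable_iff_integrableOn_Ioc_of_le zero_le_one,
    MeasureTheory.integrableOn_congr_fun hcongr measurableSet_Ioc] at hint
  refine ⟨by simpa using! hint.re, ?_⟩
  have h := Complex.betaIntegral_eq_Gamma_mul_div a b (by simpa) (by simpa)
  rw [Complex.betaIntegral, intervalIntegral.integral_of_le zero_le_one,
    setIntegral_congr_fun measurableSet_Ioc hcongr, integral_complex_ofReal,
    ← Complex.ofReal_add, Complex.Gamma_ofReal, Complex.Gamma_ofReal, Complex.Gamma_ofReal] at h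
  exact_mod_cast h

lemma besselJ_summable_and_abs_le {μ x : ℝ} (hμ : 0 < μ) (hx : 0 < x) :
    Summable (fun m : ℕ ↦ (-1 : ℝ) ^ m * (x / 2) ^ (2 * (m : ℝ) + (μ - 1 / 2)) /
      ((m.factorial : ℝ) * Real.Gamma ((m : ℝ) + (μ - 1 / 2) + 1))) ∧
    |besselJ (μ - 1 / 2) x| ≤ (x / 2) ^ (μ - 1 / 2) / Real.Gamma (μ + 1 / 2) := by
  set F : ℕ → ℝ → ℝ := fun m v ↦ (-1 : ℝ) ^ m * x ^ (2 * m) / ((2 * m).factorial : ℝ) *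
    (v ^ ((m + 1 / 2 : ℝ) - 1) * (1 - v) ^ (μ - 1)) with hF
  set wt : ℝ → ℝ := fun v ↦ v ^ ((1 / 2 : ℝ) - 1) * (1 - v) ^ (μ - 1) with hwt
  obtain ⟨hwtint, hwtval⟩ := integrableOn_and_integral_beta (a := 1 / 2) one_half_pos hμ
  have hpos (m : ℕ) : (0 : ℝ) < m + 1 / 2 := by positivity
  have hFwt (m : ℕ) : EqOn (F m) (fun v ↦ (-1 : ℝ) ^ m * (x * √v) ^ (2 * m) /
      ((2 * m).factorial : ℝ) * wt v) (Ioc 0 1) := by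
    intro v hv
    have : (x * √v) ^ (2 * m) = x ^ (2 * m) * v ^ m := by
      rw [mul_pow, pow_mul (√v), Real.sq_sqrt hv.1.le]
    simp only [hF, hwt]
    rw [this, add_sub_assoc, Real.rpow_add hv.1, Real.rpow_natCast]
    ring
  have hwt0 : ∀ v ∈ Ioc (0 : ℝ) 1, 0 ≤ wt v := fun v hv ↦
    mul_nonneg (Real.rpow_nonneg hv.1.le _) (Real.rpow_nonneg (by linarith [hv.2]) _)
  have hFint (m : ℕ) : IntegrableOn (F m) (Ioc 0 1) :=
    (integrableOn_and_integral_beta (hpos m) hμ).1.const_mul _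
  have hFle (m : ℕ) : ∀ v ∈ Ioc (0 : ℝ) 1, ‖F m v‖ ≤ x ^ (2 * m) / ((2 * m).factorial : ℝ) * wt v := by
    intro v hv
    rw [hFwt m hv, norm_mul, norm_div, norm_mul, norm_pow, norm_neg, norm_one, one_pow, one_mul,
      Real.norm_of_nonneg (hwt0 v hv), Real.norm_of_nonneg (by positivity),
      Real.norm_of_nonneg (by positivity)]
    have : x * √v ≤ x := mul_le_of_le_one_right hx.le (Real.sqrt_le_one.2 hv.2)
    have := hwt0 v hv
    gcongr
  have hFsum : Summable fun m ↦ ∫ v in Ioc (0 : ℝ) 1, ‖F m v‖ := by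
    refine Summable.of_nonneg_of_le (fun m ↦ integral_nonneg fun v ↦ norm_nonneg _) (fun m ↦ ?_)
      ((Real.hasSum_cosh x).summable.mul_right (∫ v in Ioc (0 : ℝ) 1, wt v))
    rw [← integral_const_mul]
    exact setIntegral_mono_on (hFint m).norm (hwtint.const_mul _) measurableSet_Ioc (hFle m)
  have hsum := hasSum_integral_of_summable_integral_norm hFint hFsum
  have hbound : ‖∫ v in Ioc (0 : ℝ) 1, ∑' m, F m v‖ ≤ ∫ v in Ioc (0 : ℝ) 1, wt v := by
    refine norm_integral_le_of_norm_le hwtint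
      (ae_restrict_of_forall_mem measurableSet_Ioc fun v hv ↦ ?_)
    have : ∑' m, F m v = Real.cos (x * √v) * wt v := by
      rw [tsum_congr fun m ↦ hFwt m hv, tsum_mul_right, (Real.hasSum_cos _).tsum_eq]
    rw [this, norm_mul, Real.norm_of_nonneg (hwt0 v hv)]
    exact mul_le_of_le_one_left (hwt0 v hv) (Real.abs_cos_le_one _)
  have hΓμ := Real.Gamma_pos_of_pos hμ
  have hΓ' : 0 < Real.Gamma (μ + 1 / 2) := Real.Gamma_pos_of_pos (by linarith)
  have hterm (m : ℕ) : (-1 : ℝ) ^ m * (x / 2) ^ (2 * (m : ℝ) + (μ - 1 / 2)) /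
      ((m.factorial : ℝ) * Real.Gamma ((m : ℝ) + (μ - 1 / 2) + 1)) =
      (x / 2) ^ (μ - 1 / 2) / (√π * Real.Gamma μ) * ∫ v in Ioc (0 : ℝ) 1, F m v := by
    have hdup := Real.Gamma_mul_Gamma_add_half (m + 1 / 2 : ℝ)
    rw [add_assoc, add_halves, Real.Gamma_nat_eq_factorial,
      show 2 * ((m : ℝ) + 1 / 2) = ((2 * m : ℕ) : ℝ) + 1 by push_cast; ring,
      Real.Gamma_nat_eq_factorial, show (1 : ℝ) - (((2 * m : ℕ) : ℝ) + 1) = -((2 * m : ℕ) : ℝ) by ring,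
      Real.rpow_neg zero_le_two, Real.rpow_natCast] at hdup
    simp only [hF]
    rw [integral_const_mul, (integrableOn_and_integral_beta (hpos m) hμ).2,
      Real.rpow_add (by positivity), show (m : ℝ) + (μ - 1 / 2) + 1 = m + 1 / 2 + μ by ring,
      show 2 * (m : ℝ) = ((2 * m : ℕ) : ℝ) by push_cast; ring, Real.rpow_natCast, div_pow x 2 (2 * m)]
    have hG : 0 < Real.Gamma (m + 1 / 2 + μ) := Real.Gamma_pos_of_pos (by positivity)
    have hf : (0 : ℝ) < m.factorial := by positivity
    have hf2 : (0 : ℝ) < (2 * m).factorial := by positivity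
    have hpi : 0 < √π := by positivity
    have hG1 : Real.Gamma (m + 1 / 2) = ((2 * m).factorial : ℝ) * (2 ^ (2 * m))⁻¹ * √π / m.factorial := by
      field_simp at hdup ⊢
      linarith
    rw [hG1]
    field_simp
  refine ⟨?_, ?_⟩
  · simp_rw [hterm]
    exact hsum.summable.mul_left _
  · rw [besselJ]
    simp_rw [hterm]
    rw [tsum_mul_left, hsum.tsum_eq, abs_mul, abs_of_nonneg (by positivity)]
    refine (mul_le_mul_of_nonneg_left hbound (by positivity)).trans_eq ?_
    simp only [hwt]
    rw [hwtval, Real.Gamma_one_half_eq, add_comm (1 / 2) μ]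
    have hpi : 0 < √π := by positivity
    field_simp

lemma aestronglyMeasurable_besselJ_comp_mul {μ r : ℝ} (hμ : 0 < μ) (hr : 0 < r) :
    AEStronglyMeasurable (fun u ↦ besselJ (μ - 1 / 2) (r * u)) (volume.restrict (Ioi 0)) := by
  refine aestronglyMeasurable_of_tendsto_ae atTop
    (f := fun N u ↦ ∑ m ∈ Finset.range N, (-1 : ℝ) ^ m *
      (r * u / 2) ^ (2 * (m : ℝ) + (μ - 1 / 2)) /
        ((m.factorial : ℝ) * Real.Gamma ((m : ℝ) + (μ - 1 / 2) + 1))) (fun N ↦ ?_) ?_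
  · exact Measurable.aestronglyMeasurable (by fun_prop)
  · exact ae_restrict_of_forall_mem measurableSet_Ioi fun u hu ↦
      (besselJ_summable_and_abs_le hμ (mul_pos hr hu)).1.hasSum.tendsto_sum_nat

lemma differentiableOn_laplace {g : ℝ → ℝ} {C s : ℝ} (hs : -1 < s)
    (hg : AEStronglyMeasurable g (volume.restrict (Ioi 0)))
    (hgC : ∀ u, 0 < u → |g u| ≤ C * u ^ s) :
    DifferentiableOn ℂ (fun z : ℂ ↦ ∫ u in Ioi (0 : ℝ), Complex.exp (-(z * u)) * (g u : ℂ))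
      {z | 0 < z.re} := by
  intro z₀ hz₀
  have hz₀' : 0 < z₀.re := hz₀
  set b := z₀.re / 2 with hb
  have hb0 : 0 < b := half_pos hz₀'
  have hgc : AEStronglyMeasurable (fun u ↦ (g u : ℂ)) (volume.restrict (Ioi 0)) :=
    Complex.continuous_ofReal.comp_aestronglyMeasurable hg
  have hmeas (z : ℂ) : AEStronglyMeasurable (fun u : ℝ ↦ Complex.exp (-(z * u)) * (g u : ℂ))
      (volume.restrict (Ioi 0)) :=
    (Continuous.aestronglyMeasurable (by fun_prop)).mul hgc
  have hmeas' (z : ℂ) : AEStronglyMeasurable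
      (fun u : ℝ ↦ -(u : ℂ) * Complex.exp (-(z * u)) * (g u : ℂ)) (volume.restrict (Ioi 0)) :=
    (Continuous.aestronglyMeasurable (by fun_prop)).mul hgc
  have hint (q : ℝ) (hq : -1 < q) : IntegrableOn (fun u : ℝ ↦ C * (u ^ q * Real.exp (-b * u)))
      (Ioi 0) := (integrableOn_rpow_mul_exp_neg_mul_rpow hq one_pos hb0 |>.congr_fun
        (fun u _ ↦ by simp) measurableSet_Ioi).const_mul _
  have hexp (z : ℂ) (hz : b < z.re) (u : ℝ) (hu : 0 < u) :
      ‖Complex.exp (-(z * u))‖ ≤ Real.exp (-b * u) := by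
    rw [Complex.norm_exp, Real.exp_le_exp]
    simp only [Complex.neg_re, Complex.mul_re, Complex.ofReal_re, Complex.ofReal_im, mul_zero,
      sub_zero]
    nlinarith
  refine (hasDerivAt_integral_of_dominated_loc_of_deriv_le (s := {z : ℂ | b < z.re})
    (F' := fun z u ↦ -(u : ℂ) * Complex.exp (-(z * u)) * (g u : ℂ))
    (bound := fun u ↦ C * (u ^ (s + 1) * Real.exp (-b * u))) ?_ (Eventually.of_forall hmeas)
    ?_ (hmeas' z₀) ?_ (hint _ (by linarith)) ?_).2.differentiableAt.differentiableWithinAt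
  · exact (isOpen_lt continuous_const Complex.continuous_re).mem_nhds (half_lt_self hz₀')
  · refine (hint s hs).mono' (hmeas z₀)
      (ae_restrict_of_forall_mem measurableSet_Ioi fun u hu ↦ ?_)
    rw [norm_mul, Complex.norm_real, Real.norm_eq_abs]
    have := hexp z₀ (half_lt_self hz₀') u hu
    have := hgC u hu
    calc _ ≤ Real.exp (-b * u) * (C * u ^ s) := by gcongr
      _ = _ := by ring
  · refine ae_restrict_of_forall_mem measurableSet_Ioi fun u hu z hz ↦ ?_
    have hu' : 0 < u := hu
    rw [norm_mul, norm_mul, norm_neg, Complex.norm_real, Complex.norm_real, Real.norm_eq_abs,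
      Real.norm_eq_abs, abs_of_pos hu', Real.rpow_add hu', Real.rpow_one]
    have := hexp z hz u hu
    have := hgC u hu
    calc _ ≤ u * Real.exp (-b * u) * (C * u ^ s) := by gcongr
      _ = _ := by ring
  · refine ae_restrict_of_forall_mem measurableSet_Ioi fun u hu z hz ↦ ?_
    have h : HasDerivAt (fun z : ℂ ↦ -(z * u)) (-(u : ℂ)) z := by
      simpa using ((hasDerivAt_id z).mul_const (u : ℂ)).fun_neg
    simpa [mul_comm] using h.cexp.mul_const (g u : ℂ)

lemma Gamma_add_natCast_eq_ascPochhammer_mul {a : ℝ} (ha : 0 < a) (m : ℕ) :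
    Real.Gamma (a + m) = (ascPochhammer ℝ m).eval a * Real.Gamma a := by
  induction m with
  | zero => simp
  | succ m ih =>
    rw [Nat.cast_succ, ← add_assoc, Real.Gamma_add_one (by positivity), ih, ascPochhammer_succ_eval]
    ring

lemma integral_exp_neg_mul_besselJ_of_lt {μ r x : ℝ} (hμ : 0 < μ) (hr : 0 < r) (hx : r < x) :
    ∫ u in Ioi (0 : ℝ), Real.exp (-(x * u)) * (u ^ (μ + 1 / 2) * besselJ (μ - 1 / 2) (r * u)) =
      2 * (2 * r) ^ (μ - 1 / 2) * Real.Gamma (μ + 1) / √π * (x * (x ^ 2 + r ^ 2) ^ (-(μ + 1))) := by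
  have hx0 : 0 < x := hr.trans hx
  set B : ℕ → ℝ := fun m ↦ (r / 2) ^ (2 * (m : ℝ) + (μ - 1 / 2)) /
    ((m.factorial : ℝ) * Real.Gamma ((m : ℝ) + (μ - 1 / 2) + 1)) with hB
  set E : ℕ → ℝ → ℝ := fun m u ↦ u ^ ((2 * m + 2 * μ + 1 : ℝ) - 1) * Real.exp (-(x * u)) with hE
  set K : ℝ := 2 * (2 * r) ^ (μ - 1 / 2) * Real.Gamma (μ + 1) / √π * x ^ (-(2 * μ + 1)) with hK
  have hB0 (m : ℕ) : 0 ≤ B m := by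
    have := Real.Gamma_pos_of_pos (s := (m : ℝ) + (μ - 1 / 2) + 1)
      (by have : (0 : ℝ) ≤ m := by positivity
          linarith)
    positivity
  have hEint (m : ℕ) : IntegrableOn (E m) (Ioi 0) :=
    (integrableOn_rpow_mul_exp_neg_mul_rpow (s := (2 * m + 2 * μ + 1 : ℝ) - 1) (p := 1) (b := x)
      (by have : (0 : ℝ) ≤ m := by positivity
          linarith) one_pos hx0).congr_fun (fun u _ ↦ by simp [hE]) measurableSet_Ioi
  have hBE (m : ℕ) : B m * ∫ u in Ioi (0 : ℝ), E m u =
      K * ((ascPochhammer ℝ m).eval (μ + 1) / (m.factorial : ℝ) * (r ^ 2 / x ^ 2) ^ m) := by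
    have hm : (0 : ℝ) ≤ m := by positivity
    have hdup := Real.Gamma_mul_Gamma_add_half (m + μ + 1 / 2)
    rw [show (m : ℝ) + μ + 1 / 2 + 1 / 2 = μ + 1 + m by ring,
      Gamma_add_natCast_eq_ascPochhammer_mul (by linarith),
      show 2 * ((m : ℝ) + μ + 1 / 2) = 2 * m + 2 * μ + 1 by ring,
      show (1 : ℝ) - (2 * m + 2 * μ + 1) = -((2 * m : ℕ) + 2 * μ) by push_cast; ring,
      Real.rpow_neg zero_le_two, Real.rpow_add two_pos, Real.rpow_natCast] at hdup
    simp only [hE, hB, hK]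
    rw [Real.integral_rpow_mul_exp_neg_mul_Ioi (by linarith) hx0,
      show (m : ℝ) + (μ - 1 / 2) + 1 = m + μ + 1 / 2 by ring]
    have hG : 0 < Real.Gamma (m + μ + 1 / 2) := Real.Gamma_pos_of_pos (by positivity)
    have h2 : (2 : ℝ) * m = (2 * m : ℕ) := by push_cast; ring
    have hxpow : (1 / x) ^ (2 * (m : ℝ) + 2 * μ + 1) =
        (x ^ (2 * m))⁻¹ * x ^ (-(2 * μ + 1)) := by
      rw [one_div, Real.inv_rpow hx0.le, ← Real.rpow_neg hx0.le, ← Real.rpow_natCast,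
        ← Real.rpow_neg hx0.le, ← Real.rpow_add hx0]
      congr 1; push_cast; ring
    have hr1 : (r / 2) ^ (2 * (m : ℝ) + (μ - 1 / 2)) * 2 ^ (2 * μ) * 2 ^ (2 * m) =
        r ^ (2 * m) * (2 * (2 * r) ^ (μ - 1 / 2)) := by
      rw [h2, Real.rpow_add (by positivity), Real.rpow_natCast, div_pow,
        Real.div_rpow hr.le zero_le_two, Real.mul_rpow zero_le_two hr.le,
        show 2 * μ = (μ - 1 / 2) + (μ - 1 / 2) + 1 by ring, Real.rpow_add two_pos,
        Real.rpow_add two_pos, Real.rpow_one]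
      field_simp
    have hΓ : Real.Gamma (2 * m + 2 * μ + 1) = Real.Gamma (m + μ + 1 / 2) *
        ((ascPochhammer ℝ m).eval (μ + 1) * Real.Gamma (μ + 1)) * (2 ^ (2 * m) * 2 ^ (2 * μ)) / √π := by
      rw [hdup]
      field_simp
    rw [hxpow, hΓ, div_pow, ← pow_mul, ← pow_mul]
    have hpi : 0 < √π := by positivity
    generalize (r / 2) ^ (2 * (m : ℝ) + (μ - 1 / 2)) = P at hr1 ⊢
    generalize (2 * r) ^ (μ - 1 / 2) = Q at hr1 ⊢
    generalize (2 : ℝ) ^ (2 * μ) = R at hr1 ⊢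
    field_simp
    linear_combination ((ascPochhammer ℝ m).eval (μ + 1)) * hr1
  have hq : ‖(((-(r ^ 2 / x ^ 2) : ℝ)) : ℂ)‖ < 1 := by
    rw [Complex.norm_real, norm_neg, Real.norm_of_nonneg (by positivity), div_lt_one (by positivity)]
    gcongr
  have hser := hasSum_ascPochhammer_mul_pow (μ + 1) hq
  have hval : (1 - ((-(r ^ 2 / x ^ 2) : ℝ) : ℂ)) ^ (-((μ + 1 : ℝ) : ℂ)) =
      (((1 + r ^ 2 / x ^ 2) ^ (-(μ + 1)) : ℝ) : ℂ) := by
    rw [Complex.ofReal_cpow (by positivity)]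
    push_cast
    simp
  rw [hval] at hser
  have hser' : HasSum (fun m : ℕ ↦ (ascPochhammer ℝ m).eval (μ + 1) / (m.factorial : ℝ) *
      (-(r ^ 2 / x ^ 2)) ^ m) ((1 + r ^ 2 / x ^ 2) ^ (-(μ + 1))) := by
    rw [← Complex.hasSum_ofReal]
    exact_mod_cast hser
  set F : ℕ → ℝ → ℝ := fun m u ↦ (-1 : ℝ) ^ m * B m * E m u with hF
  have hFint (m : ℕ) : IntegrableOn (F m) (Ioi 0) := (hEint m).const_mul _
  have hFnorm (m : ℕ) : ∫ u in Ioi (0 : ℝ), ‖F m u‖ =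
      K * ((ascPochhammer ℝ m).eval (μ + 1) / (m.factorial : ℝ) * (r ^ 2 / x ^ 2) ^ m) := by
    rw [← hBE, ← integral_const_mul]
    refine setIntegral_congr_fun measurableSet_Ioi fun u hu ↦ ?_
    have hu' : 0 < u := hu
    have : 0 ≤ E m u := by positivity
    simp only [hF]
    rw [norm_mul, norm_mul, norm_pow, norm_neg, norm_one, one_pow, one_mul,
      Real.norm_of_nonneg (hB0 m), Real.norm_of_nonneg this]
  have hFsum : Summable fun m ↦ ∫ u in Ioi (0 : ℝ), ‖F m u‖ := by
    simp_rw [hFnorm]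
    refine (hser'.summable.abs.congr fun m ↦ ?_).mul_left K
    have := ascPochhammer_pos m (μ + 1) (by linarith)
    rw [abs_mul, abs_pow, abs_neg, abs_of_nonneg (by positivity : 0 ≤ r ^ 2 / x ^ 2),
      abs_of_nonneg (by positivity)]
  have hsum := (hasSum_integral_of_summable_integral_norm hFint hFsum).tsum_eq
  have hpt : ∫ u in Ioi (0 : ℝ), Real.exp (-(x * u)) * (u ^ (μ + 1 / 2) *
      besselJ (μ - 1 / 2) (r * u)) = ∫ u in Ioi (0 : ℝ), ∑' m, F m u := by
    refine setIntegral_congr_fun measurableSet_Ioi fun u hu ↦ ?_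
    have hu' : 0 < u := hu
    simp only [besselJ]
    rw [← tsum_mul_left, ← tsum_mul_left]
    refine tsum_congr fun m ↦ ?_
    simp only [hF, hB, hE]
    rw [show r * u / 2 = r / 2 * u by ring, Real.mul_rpow (by positivity) hu'.le,
      show (2 * m + 2 * μ + 1 : ℝ) - 1 = (μ + 1 / 2) + (2 * m + (μ - 1 / 2)) by ring,
      Real.rpow_add hu' (μ + 1 / 2)]
    ring
  rw [hpt, ← hsum]
  have hFI (m : ℕ) : ∫ u in Ioi (0 : ℝ), F m u = K * ((ascPochhammer ℝ m).eval (μ + 1) /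
      (m.factorial : ℝ) * (-(r ^ 2 / x ^ 2)) ^ m) := by
    simp only [hF]
    rw [integral_const_mul, mul_assoc, hBE, neg_pow (r ^ 2 / x ^ 2)]
    ring
  simp_rw [hFI]
  have hpow : x * (x ^ 2 + r ^ 2) ^ (-(μ + 1)) =
      x ^ (-(2 * μ + 1)) * (1 + r ^ 2 / x ^ 2) ^ (-(μ + 1)) := by
    have hx2 : (x ^ 2) ^ (-(μ + 1)) = x ^ (2 * -(μ + 1)) := by
      rw [← Real.rpow_natCast, ← Real.rpow_mul hx0.le, Nat.cast_two]
    rw [show x ^ 2 + r ^ 2 = x ^ 2 * (1 + r ^ 2 / x ^ 2) by field_simp,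
      Real.mul_rpow (by positivity) (by positivity), hx2,
      show -(2 * μ + 1) = 1 + 2 * -(μ + 1) by ring, Real.rpow_add hx0, Real.rpow_one, mul_assoc]
  rw [tsum_mul_left, hser'.tsum_eq, hK, hpow]
  ring

lemma abs_rpow_mul_besselJ_le {μ r : ℝ} (hμ : 0 < μ) (hr : 0 < r) {u : ℝ} (hu : 0 < u) :
    |u ^ (μ + 1 / 2) * besselJ (μ - 1 / 2) (r * u)| ≤
      (r / 2) ^ (μ - 1 / 2) / Real.Gamma (μ + 1 / 2) * u ^ (2 * μ) := by
  rw [abs_mul, abs_of_pos (by positivity)]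
  refine (mul_le_mul_of_nonneg_left (besselJ_summable_and_abs_le hμ (mul_pos hr hu)).2
    (by positivity)).trans_eq ?_
  rw [show r * u / 2 = r / 2 * u by ring, Real.mul_rpow (by positivity) hu.le,
    show 2 * μ = (μ + 1 / 2) + (μ - 1 / 2) by ring, Real.rpow_add hu (μ + 1 / 2)]
  ring

lemma aestronglyMeasurable_rpow_mul_besselJ {μ r : ℝ} (hμ : 0 < μ) (hr : 0 < r) :
    AEStronglyMeasurable (fun u ↦ u ^ (μ + 1 / 2) * besselJ (μ - 1 / 2) (r * u))
      (volume.restrict (Ioi 0)) :=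
  (Measurable.aestronglyMeasurable (by fun_prop)).mul
    (aestronglyMeasurable_besselJ_comp_mul hμ hr)

lemma integral_exp_neg_mul_besselJ {μ r x : ℝ} (hμ : 0 < μ) (hr : 0 < r) (hx : 0 < x) :
    ∫ u in Ioi (0 : ℝ), Real.exp (-(x * u)) * (u ^ (μ + 1 / 2) * besselJ (μ - 1 / 2) (r * u)) =
      2 * (2 * r) ^ (μ - 1 / 2) * Real.Gamma (μ + 1) / √π * (x * (x ^ 2 + r ^ 2) ^ (-(μ + 1))) := by
  set g : ℝ → ℝ := fun u ↦ u ^ (μ + 1 / 2) * besselJ (μ - 1 / 2) (r * u) with hg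
  set K : ℝ := 2 * (2 * r) ^ (μ - 1 / 2) * Real.Gamma (μ + 1) / √π with hK
  set U : Set ℂ := {z | 0 < z.re} with hU
  set f₁ : ℂ → ℂ := fun z ↦ ∫ u in Ioi (0 : ℝ), Complex.exp (-(z * u)) * (g u : ℂ) with hf₁
  set f₂ : ℂ → ℂ := fun z ↦ K * (z * (z ^ 2 + r ^ 2) ^ (-(μ + 1) : ℂ)) with hf₂
  have hUo : IsOpen U := isOpen_lt continuous_const Complex.continuous_re
  have h₁ (y : ℝ) : f₁ y = ((∫ u in Ioi (0 : ℝ), Real.exp (-(y * u)) * g u : ℝ) : ℂ) := by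
    rw [← integral_complex_ofReal]
    simp [hf₁]
  have h₂ (y : ℝ) : f₂ y = ((K * (y * (y ^ 2 + r ^ 2) ^ (-(μ + 1))) : ℝ) : ℂ) := by
    simp only [hf₂]
    push_cast [Complex.ofReal_cpow (by positivity : 0 ≤ y ^ 2 + r ^ 2)]
    rfl
  have hd₁ : DifferentiableOn ℂ f₁ U := differentiableOn_laplace (s := 2 * μ) (by linarith)
    (aestronglyMeasurable_rpow_mul_besselJ hμ hr) fun u hu ↦ abs_rpow_mul_besselJ_le hμ hr hu
  have hd₂ : DifferentiableOn ℂ f₂ U := by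
    intro z hz
    have hz' : 0 < z.re := hz
    have hslit : z ^ 2 + (r : ℂ) ^ 2 ∈ Complex.slitPlane := by
      rw [Complex.mem_slitPlane_iff]
      have hre : (z ^ 2 + (r : ℂ) ^ 2).re = z.re * z.re - z.im * z.im + r * r := by simp [sq]
      have him : (z ^ 2 + (r : ℂ) ^ 2).im = z.re * z.im + z.im * z.re := by simp [sq]
      rw [hre, him]
      by_cases h : z.im = 0
      · left
        rw [h]
        nlinarith [mul_pos hr hr]
      · right
        have : z.re * z.im ≠ 0 := mul_ne_zero hz'.ne' h
        intro h'
        apply this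
        linarith
    have : DifferentiableAt ℂ (fun z : ℂ ↦ (z ^ 2 + (r : ℂ) ^ 2) ^ (-(μ + 1) : ℂ)) z :=
      DifferentiableAt.cpow_const (by fun_prop) hslit
    exact ((differentiableAt_id.mul this).const_mul _).differentiableWithinAt
  have hconn : IsPreconnected U := (convex_halfSpace_re_gt 0).isPreconnected
  have hseq : Tendsto (fun n : ℕ ↦ ((r + 1 + 1 / ((n : ℝ) + 1) : ℝ) : ℂ)) atTop
      (𝓝[≠] ((r + 1 : ℝ) : ℂ)) := by
    refine tendsto_nhdsWithin_iff.2 ⟨?_, Eventually.of_forall fun n ↦ ?_⟩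
    · have := (tendsto_one_div_add_atTop_nhds_zero_nat (𝕜 := ℝ)).const_add (r + 1)
      rw [add_zero] at this
      exact (Complex.continuous_ofReal.tendsto _).comp this
    · have : (0 : ℝ) < 1 / ((n : ℝ) + 1) := by positivity
      simp only [mem_compl_iff, mem_singleton_iff, Complex.ofReal_inj]
      linarith
  have hfreq : ∃ᶠ z in 𝓝[≠] ((r + 1 : ℝ) : ℂ), f₁ z = f₂ z := by
    refine hseq.frequently (Frequently.of_forall fun n ↦ ?_)
    have : (0 : ℝ) < 1 / ((n : ℝ) + 1) := by positivity
    rw [h₁, h₂, integral_exp_neg_mul_besselJ_of_lt hμ hr (by linarith)]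
  have heq := (hd₁.analyticOnNhd hUo).eqOn_of_preconnected_of_frequently_eq
    (hd₂.analyticOnNhd hUo) hconn (z₀ := ((r + 1 : ℝ) : ℂ))
    (by simp only [hU, mem_ofPred_eq, Complex.ofReal_re]; linarith) hfreq
  have hxe := heq (x := (x : ℂ)) (by simpa [hU] using hx)
  rw [h₁, h₂] at hxe
  exact_mod_cast hxe

lemma tsum_mathieu_eq_integral {r μ ν : ℝ} (t : ℝ) (hr : 0 < r) (hμ : 0 < μ) (hν : 0 < ν)
    (hν' : ν < 2 * μ + 1) :
    (∑' n : ℕ+, Complex.exp (Complex.I * (n : ℂ) * (t : ℂ)) *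
        ((2 * (n : ℝ) * (ascPochhammer ℝ (n : ℕ)).eval ν /
          (((n : ℝ) ^ 2 + r ^ 2) ^ (μ + 1) * ((n : ℕ).factorial : ℝ)) : ℝ) : ℂ)) =
      ((Real.sqrt π / ((2 * r) ^ (μ - 1 / 2) * Real.Gamma (μ + 1)) : ℝ) : ℂ) *
        ∫ u in Set.Ioi (0 : ℝ),
          ((u ^ (μ + 1 / 2) : ℝ) : ℂ) *
            ((1 - Complex.exp (Complex.I * (t : ℂ) - (u : ℂ))) ^ (-(ν : ℂ)) - 1) *
            ((besselJ (μ - 1 / 2) (r * u) : ℝ) : ℂ) := by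
  set g : ℝ → ℝ := fun u ↦ u ^ (μ + 1 / 2) * besselJ (μ - 1 / 2) (r * u) with hg
  set c : ℕ → ℝ := fun n ↦ (ascPochhammer ℝ n).eval ν / (n.factorial : ℝ) with hc
  set M : ℝ := (r / 2) ^ (μ - 1 / 2) / Real.Gamma (μ + 1 / 2) with hM
  set F : ℕ+ → ℝ → ℂ := fun n u ↦ (Complex.exp (Complex.I * (n : ℂ) * (t : ℂ)) * (c n : ℂ)) *
    ((Real.exp (-(n * u)) * g u : ℝ) : ℂ) with hF
  have hc0 (n : ℕ) : 0 ≤ c n := by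
    have := ascPochhammer_pos n ν hν
    positivity
  have hn (n : ℕ+) : (0 : ℝ) < n := by exact_mod_cast n.pos
  have hexp (n : ℕ+) : ‖Complex.exp (Complex.I * (n : ℂ) * (t : ℂ))‖ = 1 := by
    simp [Complex.norm_exp]
  have hgm := aestronglyMeasurable_rpow_mul_besselJ hμ hr
  have hdom (n : ℕ+) : IntegrableOn (fun u ↦ M * (u ^ ((2 * μ + 1) - 1) * Real.exp (-(n * u))))
      (Ioi 0) :=
    ((integrableOn_rpow_mul_exp_neg_mul_rpow (s := 2 * μ + 1 - 1) (p := 1) (b := n)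
      (by linarith) one_pos (hn n)).congr_fun (fun u _ ↦ by simp) measurableSet_Ioi).const_mul _
  have hle (n : ℕ+) : ∀ u ∈ Ioi (0 : ℝ), ‖Real.exp (-(n * u)) * g u‖ ≤
      M * (u ^ ((2 * μ + 1) - 1) * Real.exp (-(n * u))) := by
    intro u hu
    rw [norm_mul, Real.norm_of_nonneg (Real.exp_pos _).le, Real.norm_eq_abs, add_sub_cancel_right]
    have := abs_rpow_mul_besselJ_le hμ hr hu
    calc _ ≤ Real.exp (-(n * u)) * (M * u ^ (2 * μ)) := by gcongr
      _ = _ := by ring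
  have hgint (n : ℕ+) : IntegrableOn (fun u ↦ Real.exp (-(n * u)) * g u) (Ioi 0) :=
    (hdom n).mono' ((Continuous.aestronglyMeasurable (by fun_prop)).mul hgm)
      (ae_restrict_of_forall_mem measurableSet_Ioi (hle n))
  have hFint (n : ℕ+) : IntegrableOn (F n) (Ioi 0) := (hgint n).ofReal.const_mul _
  have hFsum : Summable fun n ↦ ∫ u in Ioi (0 : ℝ), ‖F n u‖ := by
    have hs := ((summable_ascPochhammer_mul_rpow_neg hν hν').comp_injective
      PNat.coe_injective).mul_right (M * Real.Gamma (2 * μ + 1))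
    refine Summable.of_nonneg_of_le (fun n ↦ integral_nonneg fun u ↦ norm_nonneg _) (fun n ↦ ?_) hs
    have h1 : ∫ u in Ioi (0 : ℝ), ‖F n u‖ = c n * ∫ u in Ioi (0 : ℝ), ‖Real.exp (-(n * u)) * g u‖ := by
      rw [← integral_const_mul]
      refine integral_congr_ae (Eventually.of_forall fun u ↦ ?_)
      simp only [hF]
      rw [norm_mul, norm_mul, hexp, one_mul, Complex.norm_real, Complex.norm_real,
        Real.norm_of_nonneg (hc0 n)]
    have h2 : ∫ u in Ioi (0 : ℝ), ‖Real.exp (-(n * u)) * g u‖ ≤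
        M * ((n : ℝ) ^ (-(2 * μ + 1)) * Real.Gamma (2 * μ + 1)) := by
      refine (setIntegral_mono_on (hgint n).norm (hdom n) measurableSet_Ioi (hle n)).trans_eq ?_
      rw [integral_const_mul, Real.integral_rpow_mul_exp_neg_mul_Ioi (by linarith) (hn n), one_div,
        Real.inv_rpow (hn n).le, ← Real.rpow_neg (hn n).le]
    rw [h1]
    refine (mul_le_mul_of_nonneg_left h2 (hc0 n)).trans_eq ?_
    simp only [hc, Function.comp_apply]
    ring
  have hsum := integral_tsum_of_summable_integral_norm hFint hFsum
  have hpt : ∫ u in Ioi (0 : ℝ), ∑' n, F n u = ∫ u in Ioi (0 : ℝ), ((u ^ (μ + 1 / 2) : ℝ) : ℂ) *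
      ((1 - Complex.exp (Complex.I * (t : ℂ) - (u : ℂ))) ^ (-(ν : ℂ)) - 1) *
      ((besselJ (μ - 1 / 2) (r * u) : ℝ) : ℂ) := by
    refine setIntegral_congr_fun measurableSet_Ioi fun u hu ↦ ?_
    have hu' : 0 < u := hu
    have hw : ‖Complex.exp (Complex.I * (t : ℂ) - (u : ℂ))‖ < 1 := by
      simpa [Complex.norm_exp] using hu'
    have hser := hasSum_ascPochhammer_mul_pow ν hw
    have hser1 := hser.tsum_eq
    rw [hser.summable.tsum_eq_zero_add] at hser1
    have hFu (n : ℕ+) : F n u = (fun k : ℕ ↦ (((ascPochhammer ℝ k).eval ν / (k.factorial : ℝ) : ℝ) : ℂ) *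
        Complex.exp (Complex.I * (t : ℂ) - (u : ℂ)) ^ k) n * (g u : ℂ) := by
      simp only [hF, hc]
      rw [← Complex.exp_nat_mul, Complex.ofReal_mul, Complex.ofReal_exp,
        show ((n : ℕ) : ℂ) * (Complex.I * t - u) = Complex.I * n * t + ((-(n * u) : ℝ) : ℂ) by
          push_cast; ring, Complex.exp_add]
      ring
    simp only [hFu]
    rw [tsum_mul_right, tsum_pnat_eq_tsum_succ (f := fun k : ℕ ↦
      (((ascPochhammer ℝ k).eval ν / (k.factorial : ℝ) : ℝ) : ℂ) *
        Complex.exp (Complex.I * (t : ℂ) - (u : ℂ)) ^ k), ← hser1]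
    simp only [hg]
    push_cast
    simp
    ring
  rw [← hpt, ← hsum, ← tsum_mul_left]
  refine tsum_congr fun n ↦ ?_
  simp only [hF]
  rw [integral_const_mul, integral_complex_ofReal, integral_exp_neg_mul_besselJ hμ hr (hn n),
    mul_left_comm, mul_assoc (Complex.exp _), ← Complex.ofReal_mul, ← Complex.ofReal_mul]
  congr 2
  simp only [hc]
  have hΓ : 0 < Real.Gamma (μ + 1) := Real.Gamma_pos_of_pos (by linarith)
  rw [Real.rpow_neg (by positivity)]
  have hpi : 0 < √π := by positivity
  have h2r : 0 < (2 * r) ^ (μ - 1 / 2) := by positivity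
  generalize (2 * r) ^ (μ - 1 / 2) = Q at h2r ⊢
  field_simp

/-- Integral representation of the characteristic function of the Mathieu
probability distribution `P_{μ+1,ν}^{(2,1)}(n, r)`:
`∑_{n≥1} e^{int} 2n(ν)_n/((n²+r²)^{μ+1} n!)`
`= (√π/((2r)^{μ-1/2} Γ(μ+1))) ∫₀^∞ u^{μ+1/2} [(1-e^{it-u})^{-ν} - 1] J_{μ-1/2}(ru) du`,
hence the characteristic function equals this integral divided by `S_{μ+1,ν}^{(2,1)}(r)`. -/
theorem mathieu_characteristic_function
    (r μ ν t : ℝ) (hr : 0 < r) (hμ : 0 < μ) (hν : 0 < ν) (hν' : ν < 2 * μ + 1)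
    (S : ℝ)
    (hS : S = ∑' n : ℕ+, 2 * (n : ℝ) * (ascPochhammer ℝ (n : ℕ)).eval ν /
        (((n : ℝ) ^ 2 + r ^ 2) ^ (μ + 1) * ((n : ℕ).factorial : ℝ))) :
    (∑' n : ℕ+, Complex.exp (Complex.I * (n : ℂ) * (t : ℂ)) *
        ((2 * (n : ℝ) * (ascPochhammer ℝ (n : ℕ)).eval ν /
          (((n : ℝ) ^ 2 + r ^ 2) ^ (μ + 1) * ((n : ℕ).factorial : ℝ)) : ℝ) : ℂ)) =
      ((Real.sqrt π / ((2 * r) ^ (μ - 1 / 2) * Real.Gamma (μ + 1)) : ℝ) : ℂ) *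
        ∫ u in Set.Ioi (0 : ℝ),
          ((u ^ (μ + 1 / 2) : ℝ) : ℂ) *
            ((1 - Complex.exp (Complex.I * (t : ℂ) - (u : ℂ))) ^ (-(ν : ℂ)) - 1) *
            ((besselJ (μ - 1 / 2) (r * u) : ℝ) : ℂ) ∧
    (∑' n : ℕ+, Complex.exp (Complex.I * (n : ℂ) * (t : ℂ)) *
        (((2 * (n : ℝ) * (ascPochhammer ℝ (n : ℕ)).eval ν /
          (((n : ℝ) ^ 2 + r ^ 2) ^ (μ + 1) * ((n : ℕ).factorial : ℝ))) / S : ℝ) : ℂ)) =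
      (((Real.sqrt π / ((2 * r) ^ (μ - 1 / 2) * Real.Gamma (μ + 1)) : ℝ) : ℂ) *
        ∫ u in Set.Ioi (0 : ℝ),
          ((u ^ (μ + 1 / 2) : ℝ) : ℂ) *
            ((1 - Complex.exp (Complex.I * (t : ℂ) - (u : ℂ))) ^ (-(ν : ℂ)) - 1) *
            ((besselJ (μ - 1 / 2) (r * u) : ℝ) : ℂ)) / (S : ℂ) := by
  refine ⟨tsum_mathieu_eq_integral t hr hμ hν hν', ?_⟩
  rw [← tsum_mathieu_eq_integral t hr hμ hν hν', ← tsum_div_const]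
  exact tsum_congr fun n ↦ by rw [Complex.ofReal_div _ S, mul_div_assoc (Complex.exp _)]
end

section
/- Let r > 0 and 1 ≤ ν < 3. Then (S_{2,ν}^{(2,1)}(r, {n}))² ≥ 2 S_{3,1}^{(2,1)}(r, {n}); explicitly, (∑_{n=1}^∞ 2n (ν)_n / ((n² + r²)² n!))² ≥ 2 ∑_{n=1}^∞ 2n / (n² + r²)³. -/
open Real
open Filter Topology

/-- A rational function of `n` and `t` whose differences interpolate between the two series in
Wilkins' inequality, written in terms of `w = n ^ 2 - n + 1 / 2 + t`. -/
noncomputable def wilkinsPotential (t w : ℝ) : ℝ :=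
  (8 * w ^ 3 - 8 * t * w ^ 2 - 12 * w ^ 2 + 42 * t * w - 34 * t ^ 2 + 5 * w - 18 * t) / (96 * w ^ 6)

/-- A lower bound for the tails of `∑ n / (n ^ 2 + t) ^ 2`, as a function of
`w = n ^ 2 - n + 1 / 2 + t`. -/
noncomputable def mathieuTailBound (t w : ℝ) : ℝ := w / (2 * (w ^ 2 - t / 3))

set_option maxRecDepth 20000 in
set_option maxHeartbeats 2000000 in
theorem wilkins_polynomial_nonneg {x t : ℝ} (hx : 0 ≤ x) (ht : 0 < t) :
    let n := x + 1
    let m := n ^ 2 + t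
    let w := m - n + 1 / 2
    let v := m + n + 1 / 2
    0 ≤ 96 * n * ((n - m) * (v ^ 2 - t / 3) + m ^ 2 * v) * (w * v) ^ 6 -
      m ^ 4 * (v ^ 2 - t / 3) *
      ((8 * w ^ 3 - 8 * t * w ^ 2 - 12 * w ^ 2 + 42 * t * w - 34 * t ^ 2 + 5 * w - 18 * t) * v ^ 6 -
        (8 * v ^ 3 - 8 * t * v ^ 2 - 12 * v ^ 2 + 42 * t * v - 34 * t ^ 2 + 5 * v - 18 * t)
          * w ^ 6) := by
  intro n m w v
  simp only [n, m, w, v]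
  -- Expanded in powers of `x` and `t`, every coefficient is positive.
  ring_nf
  positivity

theorem mathieuTailBound_sub_le {x t : ℝ} (hx : 0 ≤ x) (ht : 0 < t) :
    let n := x + 1
    let m := n ^ 2 + t
    mathieuTailBound t (m - n + 1 / 2) - mathieuTailBound t (m + n + 1 / 2) ≤ n / m ^ 2 := by
  intro n m
  have hm : 0 < m := by positivity
  have hw : t + 1 / 2 ≤ m - n + 1 / 2 := by simp only [m, n]; nlinarith
  have hv : t + 1 / 2 ≤ m + n + 1 / 2 := by simp only [m, n]; nlinarith
  have hwD : 0 < (m - n + 1 / 2) ^ 2 - t / 3 := by nlinarith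
  have hvD : 0 < (m + n + 1 / 2) ^ 2 - t / 3 := by nlinarith
  have hn : 0 < n := by positivity
  have key : n / m ^ 2 -
      (mathieuTailBound t (m - n + 1 / 2) - mathieuTailBound t (m + n + 1 / 2)) =
      n * ((m / 2 - 4 * t / 3) ^ 2 + t / 3 + 1 / 16) /
        (m ^ 2 * ((m - n + 1 / 2) ^ 2 - t / 3) * ((m + n + 1 / 2) ^ 2 - t / 3)) := by
    have hnt : t = m - n ^ 2 := by simp only [m]; ring
    clear_value m n
    unfold mathieuTailBound
    rw [div_sub_div _ _ (by positivity) (by positivity),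
      div_sub_div _ _ (by positivity) (by positivity), div_eq_div_iff (by positivity) (by positivity)]
    subst hnt
    ring
  have : 0 ≤ n * ((m / 2 - 4 * t / 3) ^ 2 + t / 3 + 1 / 16) /
      (m ^ 2 * ((m - n + 1 / 2) ^ 2 - t / 3) * ((m + n + 1 / 2) ^ 2 - t / 3)) := by
    positivity
  linarith

theorem wilkinsPotential_sub_le {x t : ℝ} (hx : 0 ≤ x) (ht : 0 < t) :
    let n := x + 1
    let m := n ^ 2 + t
    wilkinsPotential t (m - n + 1 / 2) - wilkinsPotential t (m + n + 1 / 2) ≤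
      n / m ^ 2 * (n / m ^ 2 + 2 * mathieuTailBound t (m + n + 1 / 2)) - n / m ^ 3 := by
  intro n m
  have hm : 0 < m := by positivity
  have hw : t + 1 / 2 ≤ m - n + 1 / 2 := by simp only [m, n]; nlinarith
  have hv : t + 1 / 2 ≤ m + n + 1 / 2 := by simp only [m, n]; nlinarith
  have hD : 0 < (m + n + 1 / 2) ^ 2 - t / 3 := by nlinarith
  have hP := wilkins_polynomial_nonneg hx ht
  simp only at hP
  change 0 ≤ 96 * n * ((n - m) * ((m + n + 1 / 2) ^ 2 - t / 3) + m ^ 2 * (m + n + 1 / 2)) *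
    ((m - n + 1 / 2) * (m + n + 1 / 2)) ^ 6 - m ^ 4 * ((m + n + 1 / 2) ^ 2 - t / 3) * _ at hP
  unfold wilkinsPotential mathieuTailBound
  change _ ≤ 96 * n * _ * _ - _ * (_ * (m + n + 1 / 2) ^ 6 - _ * (m - n + 1 / 2) ^ 6) at hP
  set w := m - n + 1 / 2
  set v := m + n + 1 / 2
  clear_value n m w v
  have hw0 : 0 < w := by linarith
  have hv0 : 0 < v := by linarith
  generalize 8 * w ^ 3 - 8 * t * w ^ 2 - 12 * w ^ 2 + 42 * t * w - 34 * t ^ 2 + 5 * w - 18 * t = p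
    at hP ⊢
  generalize 8 * v ^ 3 - 8 * t * v ^ 2 - 12 * v ^ 2 + 42 * t * v - 34 * t ^ 2 + 5 * v - 18 * t = q
    at hP ⊢
  generalize v ^ 2 - t / 3 = D at hP hD ⊢
  rw [← sub_nonneg]
  convert! div_nonneg hP (by positivity : 0 ≤ 96 * m ^ 4 * D * (w * v) ^ 6) using 1
  field_simp
  ring

theorem tsum_le_sq_tsum_of_telescoping {a b G K : ℕ → ℝ} (ha : ∀ k, 0 ≤ a k) (hb : ∀ k, 0 ≤ b k)
    (hsum : Summable a) (hG : Tendsto G atTop (𝓝 0)) (hK : Tendsto K atTop (𝓝 0)) (hK0 : 0 ≤ K 0)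
    (hGa : ∀ k, G k - G (k + 1) ≤ a k)
    (hKb : ∀ k, K k - K (k + 1) ≤ a k * (a k + 2 * G (k + 1)) - b k) :
    ∑' k, b k ≤ (∑' k, a k) ^ 2 := by
  set T : ℕ → ℝ := fun k ↦ ∑' j, a (j + k) with hT
  have hTsucc (k : ℕ) : T k = a k + T (k + 1) := by
    have := ((summable_nat_add_iff k).2 hsum).tsum_eq_zero_add
    simpa [hT, add_assoc, add_comm 1 k] using this
  have hGT (k : ℕ) : G k ≤ T k := by
    have hlim : Tendsto (fun N ↦ G k - G (N + k)) atTop (𝓝 (G k - 0)) :=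
      tendsto_const_nhds.sub ((tendsto_add_atTop_iff_nat k).2 hG)
    rw [sub_zero] at hlim
    refine le_of_tendsto' hlim fun N ↦ ?_
    calc G k - G (N + k) = ∑ j ∈ Finset.range N, (G (j + k) - G (j + 1 + k)) := by
          rw [Finset.sum_range_sub' (fun j ↦ G (j + k))]; simp
      _ ≤ ∑ j ∈ Finset.range N, a (j + k) :=
          Finset.sum_le_sum fun j _ ↦ by simpa [add_right_comm] using hGa (j + k)
      _ ≤ T k := ((summable_nat_add_iff k).2 hsum).sum_le_tsum _ fun j _ ↦ ha _
  have hT0 : Tendsto T atTop (𝓝 0) := tendsto_sum_nat_add a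
  have hstep (k : ℕ) : b k ≤ (T k ^ 2 - K k) - (T (k + 1) ^ 2 - K (k + 1)) := by
    have := mul_le_mul_of_nonneg_left (hGT (k + 1)) (ha k)
    rw [hTsucc k]
    linarith [hKb k]
  have hpart (N : ℕ) : ∑ k ∈ Finset.range N, b k ≤ (T 0 ^ 2 - K 0) - (T N ^ 2 - K N) :=
    (Finset.sum_le_sum fun k _ ↦ hstep k).trans_eq
      (Finset.sum_range_sub' (fun k ↦ T k ^ 2 - K k) N)
  have hlim : Tendsto (fun N ↦ (T 0 ^ 2 - K 0) - (T N ^ 2 - K N)) atTop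
      (𝓝 ((T 0 ^ 2 - K 0) - (0 ^ 2 - 0))) :=
    tendsto_const_nhds.sub ((hT0.pow 2).sub hK)
  have hbound (N : ℕ) : ∑ k ∈ Finset.range N, b k ≤ T 0 ^ 2 := by
    refine (ge_of_tendsto hlim ?_).trans (by linarith)
    filter_upwards [eventually_ge_atTop N] with M hM
    exact (Finset.sum_le_sum_of_subset_of_nonneg (Finset.range_mono hM) fun k _ _ ↦ hb k).trans
      (hpart M)
  exact Real.tsum_le_of_sum_range_le hb hbound

theorem tendsto_mathieuTailBound (t : ℝ) : Tendsto (mathieuTailBound t) atTop (𝓝 0) := by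
  have h : Tendsto (fun u : ℝ ↦ u / (2 * (1 - t / 3 * u ^ 2))) (𝓝 0)
      (𝓝 (0 / (2 * (1 - t / 3 * 0 ^ 2)))) :=
    ContinuousAt.tendsto (f := fun u : ℝ ↦ u / (2 * (1 - t / 3 * u ^ 2)))
      (ContinuousAt.div (by fun_prop) (by fun_prop) (by norm_num))
  rw [zero_div] at h
  refine (h.comp tendsto_inv_atTop_zero).congr' ?_
  filter_upwards [eventually_gt_atTop 0] with w hw
  have : 1 - t / 3 * w⁻¹ ^ 2 = (w ^ 2 - t / 3) / w ^ 2 := by field_simp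
  simp only [Function.comp_apply, mathieuTailBound, this]
  rcases eq_or_ne (w ^ 2 - t / 3) 0 with h0 | h0
  · simp [h0]
  · field_simp

theorem tendsto_wilkinsPotential (t : ℝ) : Tendsto (wilkinsPotential t) atTop (𝓝 0) := by
  have h : Continuous fun u : ℝ ↦ (8 * u ^ 3 - 8 * t * u ^ 4 - 12 * u ^ 4 + 42 * t * u ^ 5 -
      34 * t ^ 2 * u ^ 6 + 5 * u ^ 5 - 18 * t * u ^ 6) / 96 := by fun_prop
  have h0 := (h.tendsto 0).comp tendsto_inv_atTop_zero
  norm_num at h0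
  refine h0.congr' ?_
  filter_upwards [eventually_gt_atTop 0] with w hw
  simp only [Function.comp_apply, wilkinsPotential]
  field_simp

/-- **Wilkins' inequality**, with `t = r ^ 2`. -/
theorem wilkins_inequality {t : ℝ} (ht : 0 < t)
    (hsum : Summable fun k : ℕ ↦ ((k : ℝ) + 1) / (((k : ℝ) + 1) ^ 2 + t) ^ 2) :
    ∑' k : ℕ, ((k : ℝ) + 1) / (((k : ℝ) + 1) ^ 2 + t) ^ 3 ≤
      (∑' k : ℕ, ((k : ℝ) + 1) / (((k : ℝ) + 1) ^ 2 + t) ^ 2) ^ 2 := by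
  set W : ℕ → ℝ := fun k ↦ ((k : ℝ) + 1) ^ 2 + t - ((k : ℝ) + 1) + 1 / 2 with hW
  have hWsucc (k : ℕ) : W (k + 1) = ((k : ℝ) + 1) ^ 2 + t + ((k : ℝ) + 1) + 1 / 2 := by
    simp only [hW]; push_cast; ring
  have hWtop : Tendsto W atTop atTop :=
    tendsto_atTop_mono (fun k ↦ by simp only [hW]; nlinarith [sq_nonneg (k : ℝ)])
      tendsto_natCast_atTop_atTop
  refine tsum_le_sq_tsum_of_telescoping (G := fun k ↦ mathieuTailBound t (W k))
    (K := fun k ↦ wilkinsPotential t (W k)) (fun k ↦ by positivity) (fun k ↦ by positivity) hsum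
    ((tendsto_mathieuTailBound t).comp hWtop) ((tendsto_wilkinsPotential t).comp hWtop) ?_
    (fun k ↦ ?_) (fun k ↦ ?_)
  · have h0 : W 0 = t + 1 / 2 := by simp only [hW]; push_cast; ring
    have : wilkinsPotential t (W 0) = 1 / (192 * (t + 1 / 2) ^ 6) := by
      rw [h0, wilkinsPotential, div_eq_div_iff (by positivity) (by positivity)]
      ring
    simp only [this]
    positivity
  · rw [hWsucc]
    exact mathieuTailBound_sub_le k.cast_nonneg ht
  · rw [hWsucc]
    exact wilkinsPotential_sub_le k.cast_nonneg ht

theorem factorial_le_ascPochhammer_eval {ν : ℝ} (hν : 1 ≤ ν) (n : ℕ) :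
    (n.factorial : ℝ) ≤ (ascPochhammer ℝ n).eval ν := by
  induction n with
  | zero => simp
  | succ n ih =>
    rw [ascPochhammer_succ_eval, Nat.factorial_succ, mul_comm (n + 1)]
    push_cast
    exact mul_le_mul ih (by linarith) (by positivity) ((Nat.cast_nonneg _).trans ih)

/-- The series telescopes: its terms are multiples of the differences of
`(ν)_n / (n! (n + 1) (n + 2))`. -/
theorem summable_ascPochhammer_eval_div {ν : ℝ} (hν : 0 < ν) (hν' : ν < 3) :
    Summable fun n : ℕ ↦
      (ascPochhammer ℝ n).eval ν / (n.factorial * (((n : ℝ) + 1) * (n + 2) * (n + 3))) := by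
  set e : ℕ → ℝ := fun n ↦ (ascPochhammer ℝ n).eval ν / (n.factorial * (((n : ℝ) + 1) * (n + 2)))
  have he (n : ℕ) : 0 < e n := by
    have := ascPochhammer_pos n ν hν
    positivity
  have h3 : 0 < 3 - ν := by linarith
  have hstep (n : ℕ) : (ascPochhammer ℝ n).eval ν /
      (n.factorial * (((n : ℝ) + 1) * (n + 2) * (n + 3))) = (e n - e (n + 1)) / (3 - ν) := by
    simp only [e, ascPochhammer_succ_eval, Nat.factorial_succ]
    push_cast
    field_simp
    ring
  refine summable_of_sum_range_le (c := e 0 / (3 - ν)) (fun n ↦ ?_) (fun N ↦ ?_)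
  · have := ascPochhammer_pos n ν hν
    positivity
  · rw [Finset.sum_congr rfl fun n _ ↦ hstep n, ← Finset.sum_div, Finset.sum_range_sub']
    gcongr
    linarith [he N]

theorem summable_mathieu_s12 {t ν : ℝ} (ht : 0 ≤ t) (hν : 0 < ν) (hν' : ν < 3) :
    Summable fun k : ℕ ↦ 2 * ((k : ℝ) + 1) * (ascPochhammer ℝ (k + 1)).eval ν /
      ((((k : ℝ) + 1) ^ 2 + t) ^ 2 * ((k + 1).factorial : ℝ)) := by
  have h := ((summable_nat_add_iff 1).2 (summable_ascPochhammer_eval_div hν hν')).mul_left 48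
  refine h.of_nonneg_of_le (fun k ↦ ?_) (fun k ↦ ?_)
  · have := ascPochhammer_pos (k + 1) ν hν
    positivity
  · have := ascPochhammer_pos (k + 1) ν hν
    have hk : (0 : ℝ) ≤ k := k.cast_nonneg
    push_cast
    generalize (ascPochhammer ℝ (k + 1)).eval ν = c at *
    have hf : (0 : ℝ) < (k + 1).factorial := by positivity
    generalize ((k + 1).factorial : ℝ) = f at *
    calc 2 * ((k : ℝ) + 1) * c / ((((k : ℝ) + 1) ^ 2 + t) ^ 2 * f)
        ≤ 2 * ((k : ℝ) + 1) * c / ((((k : ℝ) + 1) ^ 2) ^ 2 * f) := by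
          gcongr
          linarith
      _ ≤ 48 * (c / (f * (((k : ℝ) + 1 + 1) * (k + 1 + 2) * (k + 1 + 3)))) := by
          rw [← mul_div_assoc, div_le_div_iff₀ (by positivity) (by positivity), ← sub_nonneg]
          ring_nf
          positivity

/-- For `r > 0` and `1 ≤ ν < 3`,
`(S_{2,ν}^{(2,1)}(r,{n}))² ≥ 2 S_{3,1}^{(2,1)}(r,{n})`, i.e.
`(∑_{n≥1} 2n(ν)_n/((n²+r²)² n!))² ≥ 2 ∑_{n≥1} 2n/(n²+r²)³`. -/
theorem mathieu_wilkins_inequality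
    (r ν : ℝ) (hr : 0 < r) (hν : 1 ≤ ν) (hν' : ν < 3) :
    (∑' n : ℕ+, 2 * (n : ℝ) * (ascPochhammer ℝ (n : ℕ)).eval ν /
          (((n : ℝ) ^ 2 + r ^ 2) ^ 2 * ((n : ℕ).factorial : ℝ))) ^ 2 ≥
      2 * ∑' n : ℕ+, 2 * (n : ℝ) / ((n : ℝ) ^ 2 + r ^ 2) ^ 3 := by
  rw [tsum_pnat_eq_tsum_succ (f := fun n : ℕ ↦ 2 * (n : ℝ) * (ascPochhammer ℝ n).eval ν /
      (((n : ℝ) ^ 2 + r ^ 2) ^ 2 * (n.factorial : ℝ))),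
    tsum_pnat_eq_tsum_succ (f := fun n : ℕ ↦ 2 * (n : ℝ) / ((n : ℝ) ^ 2 + r ^ 2) ^ 3)]
  push_cast
  have ht : 0 < r ^ 2 := by positivity
  have hS := summable_mathieu_s12 ht.le (by linarith : 0 < ν) hν'
  have hle (k : ℕ) : 2 * (((k : ℝ) + 1) / (((k : ℝ) + 1) ^ 2 + r ^ 2) ^ 2) ≤
      2 * ((k : ℝ) + 1) * (ascPochhammer ℝ (k + 1)).eval ν /
        ((((k : ℝ) + 1) ^ 2 + r ^ 2) ^ 2 * ((k + 1).factorial : ℝ)) := by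
    rw [← mul_div_assoc, div_le_div_iff₀ (by positivity) (by positivity)]
    have := mul_le_mul_of_nonneg_left (factorial_le_ascPochhammer_eval hν (k + 1))
      (by positivity : 0 ≤ 2 * ((k : ℝ) + 1) * (((k : ℝ) + 1) ^ 2 + r ^ 2) ^ 2)
    linarith
  have hA2 := hS.of_nonneg_of_le (fun k ↦ by positivity) hle
  have hA := (summable_mul_left_iff two_ne_zero).1 hA2
  have hAS := hA2.tsum_le_tsum hle hS
  rw [tsum_mul_left] at hAS
  have hW := wilkins_inequality ht hA
  have hA0 : 0 ≤ ∑' k : ℕ, ((k : ℝ) + 1) / (((k : ℝ) + 1) ^ 2 + r ^ 2) ^ 2 :=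
    tsum_nonneg fun k ↦ by positivity
  have hB : ∑' k : ℕ, 2 * ((k : ℝ) + 1) / (((k : ℝ) + 1) ^ 2 + r ^ 2) ^ 3 =
      2 * ∑' k : ℕ, ((k : ℝ) + 1) / (((k : ℝ) + 1) ^ 2 + r ^ 2) ^ 3 := by
    rw [← tsum_mul_left]
    exact tsum_congr fun k ↦ mul_div_assoc _ _ _
  rw [hB]
  have := pow_le_pow_left₀ (by positivity) hAS 2
  linarith
end

section
/- Let α, β, μ, ν > 0, let 0 ≤ z ≤ 1, and let a = (a_n)_{n≥1} be a positive sequence such that the series ζ_{μ,ν}(α,β,z) = ∑_{n=1}^∞ (ν)_n z^n / (n! a_n^{αμ−β}) converges. Then the function g(r) = S_{μ,ν}^{(α,β)}(√r, a; z) = ∑_{n=1}^∞ 2 a_n^β (ν)_n z^n / ((a_n^α + r)^μ n!) is completely monotonic on (0, ∞); that is, g has derivatives of all orders on (0, ∞) and (−1)^k g^{(k)}(r) ≥ 0 for every integer k ≥ 0 and every r > 0. -/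
open Real

lemma summable_mul_add_rpow_neg {ι : Type*} {b c : ι → ℝ} {μ s x : ℝ} (hb : ∀ i, 0 < b i)
    (hc : ∀ i, 0 ≤ c i) (hμ : 0 ≤ μ) (hs : μ ≤ s) (hx : 0 < x)
    (hsum : Summable fun i => c i * b i ^ (-μ)) :
    Summable fun i => c i * (b i + x) ^ (-s) := by
  refine .of_nonneg_of_le (fun i => mul_nonneg (hc i) (rpow_nonneg (add_pos (hb i) hx).le _))
    (fun i => ?_) (hsum.mul_right (x ^ (-(s - μ))))
  have hbx : 0 < b i + x := add_pos (hb i) hx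
  calc c i * (b i + x) ^ (-s) = c i * ((b i + x) ^ (-μ) * (b i + x) ^ (-(s - μ))) := by
        rw [← rpow_add hbx]; ring_nf
    _ ≤ c i * (b i ^ (-μ) * x ^ (-(s - μ))) :=
        mul_le_mul_of_nonneg_left (mul_le_mul
          (rpow_le_rpow_of_nonpos (hb i) (by linarith) (by linarith))
          (rpow_le_rpow_of_nonpos hx (by linarith [hb i]) (by linarith))
          (rpow_nonneg hbx.le _) (rpow_nonneg (hb i).le _)) (hc i)
    _ = c i * b i ^ (-μ) * x ^ (-(s - μ)) := by ring

lemma hasDerivAt_tsum_mul_add_rpow_neg {ι : Type*} {b c : ι → ℝ} {μ s x : ℝ}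
    (hb : ∀ i, 0 < b i) (hc : ∀ i, 0 ≤ c i) (hμ : 0 ≤ μ) (hs : μ ≤ s) (hx : 0 < x)
    (hsum : Summable fun i => c i * b i ^ (-μ)) :
    HasDerivAt (fun y => ∑' i, c i * (b i + y) ^ (-s))
      (-s * ∑' i, c i * (b i + x) ^ (-(s + 1))) x := by
  have hx2 : 0 < x / 2 := half_pos hx
  have hxmem : x ∈ Set.Ioi (x / 2) := half_lt_self hx
  rw [← tsum_mul_left]
  refine hasDerivAt_tsum_of_isPreconnected
    (g' := fun i y => -s * (c i * (b i + y) ^ (-(s + 1))))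
    ((summable_mul_add_rpow_neg hb hc hμ (s := s + 1) (by linarith) hx2 hsum).mul_left s)
    isOpen_Ioi isPreconnected_Ioi (fun i y hy => ?_) (fun i y hy => ?_) hxmem
    (summable_mul_add_rpow_neg hb hc hμ hs hx hsum) hxmem
  · have hby : 0 < b i + y := add_pos (hb i) (hx2.trans hy)
    have h := (((hasDerivAt_id y).const_add (b i)).rpow_const (p := -s)
      (Or.inl hby.ne')).const_mul (c i)
    refine h.congr_deriv ?_
    rw [neg_add']
    simp only [id]
    ring
  · have hby : 0 < b i + y := add_pos (hb i) (hx2.trans hy)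
    rw [norm_of_nonpos (by
      have := mul_nonneg (hμ.trans hs) (mul_nonneg (hc i) (rpow_nonneg hby.le (-(s + 1))))
      linarith), neg_mul, neg_neg]
    refine mul_le_mul_of_nonneg_left (mul_le_mul_of_nonneg_left ?_ (hc i)) (hμ.trans hs)
    exact rpow_le_rpow_of_nonpos (add_pos (hb i) hx2) (by linarith [Set.mem_Ioi.1 hy])
      (by linarith)

lemma iteratedDerivWithin_tsum_mul_add_rpow_neg {ι : Type*} {b c : ι → ℝ} {μ : ℝ}
    (hb : ∀ i, 0 < b i) (hc : ∀ i, 0 ≤ c i) (hμ : 0 ≤ μ)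
    (hsum : Summable fun i => c i * b i ^ (-μ)) (k : ℕ) :
    Set.EqOn (iteratedDerivWithin k (fun y => ∑' i, c i * (b i + y) ^ (-μ)) (Set.Ioi 0))
      (fun x => (-1) ^ k * (ascPochhammer ℝ k).eval μ * ∑' i, c i * (b i + x) ^ (-(μ + k)))
      (Set.Ioi 0) := by
  induction k with
  | zero => intro x _; simp
  | succ k ih =>
    intro x hx
    rw [iteratedDerivWithin_succ, derivWithin_congr ih (ih hx),
      (((hasDerivAt_tsum_mul_add_rpow_neg hb hc hμ (s := μ + k) (by simp) hx hsum).const_mul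
        ((-1) ^ k * (ascPochhammer ℝ k).eval μ)).hasDerivWithinAt).derivWithin
        (uniqueDiffOn_Ioi 0 x hx), ascPochhammer_succ_eval]
    push_cast
    rw [add_assoc μ]
    ring

/-- The function `g(r) = S_{μ,ν}^{(α,β)}(√r, a; z)
= ∑_{n≥1} 2 a_n^β (ν)_n z^n / ((a_n^α + r)^μ n!)` is completely monotonic on `(0,∞)`:
`g` is smooth there and `(-1)^k g^{(k)}(r) ≥ 0` for all `k ≥ 0` and `r > 0`. -/
theorem mathieu_completely_monotonic
    (α β μ ν z : ℝ) (a : ℕ+ → ℝ)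
    (hα : 0 < α) (hβ : 0 < β) (hμ : 0 < μ) (hν : 0 < ν)
    (hz0 : 0 ≤ z) (hz1 : z ≤ 1) (ha : ∀ n, 0 < a n)
    (hζ : Summable fun n : ℕ+ =>
      (ascPochhammer ℝ (n : ℕ)).eval ν * z ^ (n : ℕ) /
        (((n : ℕ).factorial : ℝ) * (a n) ^ (α * μ - β)))
    (g : ℝ → ℝ)
    (hg : ∀ x : ℝ, g x = ∑' n : ℕ+, 2 * (a n) ^ β * (ascPochhammer ℝ (n : ℕ)).eval ν *
        z ^ (n : ℕ) / (((a n) ^ α + x) ^ μ * ((n : ℕ).factorial : ℝ))) :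
    ContDiffOn ℝ (⊤ : ℕ∞) g (Set.Ioi 0) ∧
      ∀ (k : ℕ), ∀ r ∈ Set.Ioi (0 : ℝ),
        0 ≤ (-1 : ℝ) ^ k * iteratedDerivWithin k g (Set.Ioi 0) r := by
  set b : ℕ+ → ℝ := fun n => a n ^ α
  set c : ℕ+ → ℝ := fun n => 2 * a n ^ β * (ascPochhammer ℝ (n : ℕ)).eval ν * z ^ (n : ℕ) /
    ((n : ℕ).factorial : ℝ)
  have hb : ∀ n, 0 < b n := fun n => rpow_pos_of_pos (ha n) α
  have hc : ∀ n, 0 ≤ c n := fun n => by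
    have := ascPochhammer_pos (n : ℕ) ν hν
    have := rpow_pos_of_pos (ha n) β
    positivity
  have hsum : Summable fun n => c n * b n ^ (-μ) := by
    refine (hζ.mul_left 2).congr fun n => ?_
    have h : b n ^ (-μ) = (a n ^ (α * μ))⁻¹ := by
      rw [← rpow_mul (ha n).le, mul_neg, rpow_neg (ha n).le]
    have := (rpow_pos_of_pos (ha n) β).ne'
    have := (rpow_pos_of_pos (ha n) (α * μ)).ne'
    have : ((n : ℕ).factorial : ℝ) ≠ 0 := by positivity
    rw [h, rpow_sub (ha n)]
    simp only [c]
    field_simp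
  have hgeq : Set.EqOn g (fun x => ∑' n, c n * (b n + x) ^ (-μ)) (Set.Ioi 0) := fun x hx => by
    rw [hg]
    refine tsum_congr fun n => ?_
    rw [rpow_neg (add_pos (hb n) hx).le, ← div_eq_mul_inv, div_div, mul_comm (_ ^ μ)]
  have hderiv (k : ℕ) := (iteratedDerivWithin_congr (n := k) hgeq).trans
    (iteratedDerivWithin_tsum_mul_add_rpow_neg hb hc hμ.le hsum k)
  refine ⟨contDiffOn_of_differentiableOn_deriv fun k _ => ?_, fun k r hr => ?_⟩
  · refine DifferentiableOn.congr (fun x hx => ?_) (hderiv k)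
    exact ((hasDerivAt_tsum_mul_add_rpow_neg hb hc hμ.le (by simp) hx
      hsum).const_mul _).differentiableAt.differentiableWithinAt
  · rw [hderiv k hr]
    simp only
    rw [← mul_assoc, ← mul_assoc, ← mul_pow]
    norm_num
    exact mul_nonneg (ascPochhammer_pos k μ hμ).le
      (tsum_nonneg fun n => mul_nonneg (hc n) (rpow_nonneg (add_pos (hb n) hr).le _))
end

section
/- Let α, β, μ, ν > 0, let 0 ≤ z ≤ 1, and let a = (a_n)_{n≥1} be a positive sequence such that the series ζ_{μ,ν}(α,β,z) = ∑_{n=1}^∞ (ν)_n z^n / (n! a_n^{αμ−β}) converges. Then the function r ↦ S_{μ,ν}^{(α,β)}(√r, a; z) is log-convex on (0, ∞); in particular, for all r₁, r₂ > 0, (S_{μ,ν}^{(α,β)}(√((r₁+r₂)/2), a; z))² ≤ S_{μ,ν}^{(α,β)}(√r₁, a; z) · S_{μ,ν}^{(α,β)}(√r₂, a; z). -/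
open Real

/-- Hölder's inequality for series, in the form of a weighted geometric mean. -/
theorem tsum_rpow_mul_rpow_le {ι : Type*} {p q : ι → ℝ} {s t : ℝ} (hs : 0 < s) (ht : 0 < t)
    (hst : s + t = 1) (hp : ∀ i, 0 ≤ p i) (hq : ∀ i, 0 ≤ q i) (hps : Summable p)
    (hqs : Summable q) :
    (Summable fun i => p i ^ s * q i ^ t) ∧
      ∑' i, p i ^ s * q i ^ t ≤ (∑' i, p i) ^ s * (∑' i, q i) ^ t := by
  have hpow (x : ℝ) (hx : 0 ≤ x) (r : ℝ) (hr : 0 < r) : (x ^ r) ^ r⁻¹ = x :=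
    Real.rpow_rpow_inv hx hr.ne'
  have hconj : s⁻¹.HolderConjugate t⁻¹ := by
    rw [Real.holderConjugate_iff]
    refine ⟨(one_lt_inv₀ hs).2 (by linarith), by simpa using hst⟩
  have h := Real.summable_and_inner_le_Lp_mul_Lq_tsum_of_nonneg hconj
    (f := fun i => p i ^ s) (g := fun i => q i ^ t)
    (fun i => Real.rpow_nonneg (hp i) s) (fun i => Real.rpow_nonneg (hq i) t)
    (by simpa only [hpow _ (hp _) s hs] using hps)
    (by simpa only [hpow _ (hq _) t ht] using hqs)
  simpa only [hpow _ (hp _) s hs, hpow _ (hq _) t ht, one_div, inv_inv] using h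

theorem rpow_neg_weighted_mean_le {μ s t x y : ℝ} (hμ : 0 ≤ μ) (hs : 0 ≤ s) (ht : 0 ≤ t)
    (hst : s + t = 1) (hx : 0 < x) (hy : 0 < y) :
    (s * x + t * y) ^ (-μ) ≤ (x ^ (-μ)) ^ s * (y ^ (-μ)) ^ t := by
  have h := Real.geom_mean_le_arith_mean2_weighted hs ht hx.le hy.le hst
  calc (s * x + t * y) ^ (-μ) ≤ (x ^ s * y ^ t) ^ (-μ) :=
        Real.rpow_le_rpow_of_nonpos (by positivity) h (by linarith)
    _ = (x ^ (-μ)) ^ s * (y ^ (-μ)) ^ t := by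
        rw [Real.mul_rpow (by positivity) (by positivity), ← Real.rpow_mul hx.le,
          ← Real.rpow_mul hy.le, ← Real.rpow_mul hx.le, ← Real.rpow_mul hy.le, mul_comm s,
          mul_comm t]

/-- A positive combination of functions `x ↦ (u i + x) ^ (-μ)` is multiplicatively convex
along weighted arithmetic means. -/
theorem tsum_mul_add_rpow_neg_le {ι : Type*} {c u : ι → ℝ} {μ s t x y : ℝ} (hμ : 0 ≤ μ)
    (hs : 0 < s) (ht : 0 < t) (hst : s + t = 1) (hc : ∀ i, 0 ≤ c i)
    (hx : ∀ i, 0 < u i + x) (hy : ∀ i, 0 < u i + y)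
    (hxs : Summable fun i => c i * (u i + x) ^ (-μ))
    (hys : Summable fun i => c i * (u i + y) ^ (-μ)) :
    ∑' i, c i * (u i + (s * x + t * y)) ^ (-μ) ≤
      (∑' i, c i * (u i + x) ^ (-μ)) ^ s * (∑' i, c i * (u i + y) ^ (-μ)) ^ t := by
  have hxn i := (Real.rpow_pos_of_pos (hx i) (-μ)).le
  have hyn i := (Real.rpow_pos_of_pos (hy i) (-μ)).le
  have hmean i : u i + (s * x + t * y) = s * (u i + x) + t * (u i + y) := by
    linear_combination (-u i) * hst
  have hle i : c i * (u i + (s * x + t * y)) ^ (-μ) ≤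
      (c i * (u i + x) ^ (-μ)) ^ s * (c i * (u i + y) ^ (-μ)) ^ t := by
    have hcs : c i ^ s * c i ^ t = c i := by
      rw [← Real.rpow_add_of_nonneg (hc i) hs.le ht.le, hst, Real.rpow_one]
    rw [Real.mul_rpow (hc i) (hxn i), Real.mul_rpow (hc i) (hyn i), mul_mul_mul_comm, hcs, hmean]
    exact mul_le_mul_of_nonneg_left
      (rpow_neg_weighted_mean_le hμ hs.le ht.le hst (hx i) (hy i)) (hc i)
  obtain ⟨hsum, hbound⟩ := tsum_rpow_mul_rpow_le hs ht hst
    (fun i => mul_nonneg (hc i) (hxn i)) (fun i => mul_nonneg (hc i) (hyn i)) hxs hys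
  refine (Summable.tsum_le_tsum hle (hsum.of_nonneg_of_le (fun i => ?_) hle) hsum).trans hbound
  have : 0 < s * (u i + x) + t * (u i + y) :=
    add_pos (mul_pos hs (hx i)) (mul_pos ht (hy i))
  rw [hmean]
  exact mul_nonneg (hc i) (Real.rpow_pos_of_pos this _).le

/-- The function `r ↦ S_{μ,ν}^{(α,β)}(√r, a; z)
= ∑_{n≥1} 2 a_n^β (ν)_n z^n / ((a_n^α + r)^μ n!)` is log-convex on `(0,∞)`; in particular
`(S_{μ,ν}^{(α,β)}(√((r₁+r₂)/2), a; z))² ≤ S_{μ,ν}^{(α,β)}(√r₁, a; z) · S_{μ,ν}^{(α,β)}(√r₂, a; z)`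
for all `r₁, r₂ > 0`. -/
theorem mathieu_log_convex
    (α β μ ν z : ℝ) (a : ℕ+ → ℝ)
    (hα : 0 < α) (hβ : 0 < β) (hμ : 0 < μ) (hν : 0 < ν)
    (hz0 : 0 ≤ z) (hz1 : z ≤ 1) (ha : ∀ n, 0 < a n)
    (hζ : Summable fun n : ℕ+ =>
      (ascPochhammer ℝ (n : ℕ)).eval ν * z ^ (n : ℕ) /
        (((n : ℕ).factorial : ℝ) * (a n) ^ (α * μ - β)))
    (g : ℝ → ℝ)
    (hg : ∀ x : ℝ, g x = ∑' n : ℕ+, 2 * (a n) ^ β * (ascPochhammer ℝ (n : ℕ)).eval ν *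
        z ^ (n : ℕ) / (((a n) ^ α + x) ^ μ * ((n : ℕ).factorial : ℝ))) :
    ConvexOn ℝ (Set.Ioi 0) (fun x => Real.log (g x)) ∧
      ∀ r₁ r₂ : ℝ, 0 < r₁ → 0 < r₂ → (g ((r₁ + r₂) / 2)) ^ 2 ≤ g r₁ * g r₂ := by
  set c : ℕ+ → ℝ := fun n =>
    2 * a n ^ β * (ascPochhammer ℝ (n : ℕ)).eval ν * z ^ (n : ℕ) / ((n : ℕ).factorial : ℝ) with hcdef
  have hP (n : ℕ+) : 0 < (ascPochhammer ℝ (n : ℕ)).eval ν := ascPochhammer_pos _ _ hν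
  have hu (n : ℕ+) : 0 < a n ^ α := Real.rpow_pos_of_pos (ha n) _
  have haβ (n : ℕ+) : 0 < a n ^ β := Real.rpow_pos_of_pos (ha n) _
  have hc (n : ℕ+) : 0 ≤ c n := by
    have := hP n
    have := haβ n
    positivity
  have hux {x : ℝ} (hx : 0 < x) (n : ℕ+) : 0 < a n ^ α + x := add_pos (hu n) hx
  have hg' {x : ℝ} (hx : 0 < x) : g x = ∑' n, c n * (a n ^ α + x) ^ (-μ) := by
    rw [hg]
    refine tsum_congr fun n => ?_
    rw [Real.rpow_neg (hux hx n).le, hcdef, ← div_eq_mul_inv, div_div, mul_comm (_ ^ μ)]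
  have hnonneg {x : ℝ} (hx : 0 < x) (n : ℕ+) : 0 ≤ c n * (a n ^ α + x) ^ (-μ) :=
    mul_nonneg (hc n) (Real.rpow_pos_of_pos (hux hx n) _).le
  have hsum {x : ℝ} (hx : 0 < x) : Summable fun n => c n * (a n ^ α + x) ^ (-μ) := by
    refine (hζ.mul_left 2).of_nonneg_of_le (hnonneg hx) fun n => ?_
    calc c n * (a n ^ α + x) ^ (-μ) ≤ c n * (a n ^ α) ^ (-μ) :=
          mul_le_mul_of_nonneg_left
            (Real.rpow_le_rpow_of_nonpos (hu n) (by linarith) (by linarith)) (hc n)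
      _ = _ := by
          have := haβ n
          have := Real.rpow_pos_of_pos (ha n) (α * μ)
          rw [← Real.rpow_mul (ha n).le, mul_neg, Real.rpow_neg (ha n).le, Real.rpow_sub (ha n)]
          simp only [hcdef]
          field_simp
  have hg0 {x : ℝ} (hx : 0 < x) : 0 ≤ g x := by
    rw [hg' hx]
    exact tsum_nonneg (hnonneg hx)
  have key {x y s t : ℝ} (hx : 0 < x) (hy : 0 < y) (hs : 0 < s) (ht : 0 < t) (hst : s + t = 1) :
      g (s * x + t * y) ≤ g x ^ s * g y ^ t := by
    rw [hg' hx, hg' hy, hg' (by positivity)]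
    exact tsum_mul_add_rpow_neg_le hμ.le hs ht hst hc (hux hx) (hux hy) (hsum hx) (hsum hy)
  constructor
  · rcases hz0.eq_or_lt with rfl | hz
    · have : g = fun _ => 0 := by
        funext x
        simp [hg]
      simpa [this] using convexOn_const (0 : ℝ) (convex_Ioi (0 : ℝ))
    have hgpos {x : ℝ} (hx : 0 < x) : 0 < g x := by
      rw [hg' hx]
      refine (hsum hx).tsum_pos (hnonneg hx) 1 ?_
      have := hP 1
      have := haβ 1
      have := Real.rpow_pos_of_pos (hux hx 1) (-μ)
      positivity
    refine convexOn_iff_forall_pos.2 ⟨convex_Ioi 0, fun x hx y hy s t hs ht hst => ?_⟩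
    have hx : 0 < x := hx
    have hy : 0 < y := hy
    have hgx := hgpos hx
    have hgy := hgpos hy
    simp only [smul_eq_mul]
    rw [← Real.log_rpow hgx, ← Real.log_rpow hgy, ← Real.log_mul (by positivity) (by positivity)]
    exact Real.log_le_log (hgpos (by positivity)) (key hx hy hs ht hst)
  · intro x y hx hy
    have h := key hx hy (s := 1 / 2) (t := 1 / 2) (by norm_num) (by norm_num) (by norm_num)
    rw [← Real.sqrt_eq_rpow, ← Real.sqrt_eq_rpow, ← Real.sqrt_mul (hg0 hx),
      show 1 / 2 * x + 1 / 2 * y = (x + y) / 2 by ring] at h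
    exact (Real.le_sqrt (hg0 (by positivity)) (mul_nonneg (hg0 hx) (hg0 hy))).1 h
end

section
/- Let α, β, μ, ν > 0, let 0 ≤ z ≤ 1, and let a = (a_n)_{n≥1} be a positive sequence such that the series ζ_{μ,ν}(α,β,z) = ∑_{n=1}^∞ (ν)_n z^n / (n! a_n^{αμ−β}) converges. Then for all r₁, r₂ > 0, S_{μ,ν}^{(α,β)}(√r₁, a; z) · S_{μ,ν}^{(α,β)}(√r₂, a; z) ≤ 2 ζ_{μ,ν}(α,β,z) · S_{μ,ν}^{(α,β)}(√(r₁+r₂), a; z). -/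
open Real

/-- The weighted Chebyshev sum inequality. -/
theorem sum_mul_sum_le_sum_mul_sum_of_monovary {ι : Type*} {w f h : ι → ℝ}
    (hw : ∀ i, 0 ≤ w i) (hfh : Monovary f h) (s : Finset ι) :
    (∑ i ∈ s, w i * f i) * ∑ i ∈ s, w i * h i ≤
      (∑ i ∈ s, w i) * ∑ i ∈ s, w i * (f i * h i) := by
  have key : 0 ≤ ∑ i ∈ s, ∑ j ∈ s, w i * w j * ((f j - f i) * (h j - h i)) :=
    Finset.sum_nonneg fun i _ => Finset.sum_nonneg fun j _ =>
      mul_nonneg (mul_nonneg (hw i) (hw j)) (monovary_iff_forall_mul_nonneg.1 hfh i j)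
  have expand : ∑ i ∈ s, ∑ j ∈ s, w i * w j * ((f j - f i) * (h j - h i)) =
      (∑ i ∈ s, w i) * (∑ i ∈ s, w i * (f i * h i)) -
        (∑ i ∈ s, w i * f i) * (∑ i ∈ s, w i * h i) -
        (∑ i ∈ s, w i * h i) * (∑ i ∈ s, w i * f i) +
        (∑ i ∈ s, w i * (f i * h i)) * (∑ i ∈ s, w i) := by
    simp only [Finset.sum_mul_sum, ← Finset.sum_sub_distrib, ← Finset.sum_add_distrib]
    refine Finset.sum_congr rfl fun i _ => Finset.sum_congr rfl fun j _ => ?_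
    ring
  linarith

/-- The weighted Chebyshev inequality for infinite series. -/
theorem tsum_mul_tsum_le_tsum_mul_tsum_of_monovary {ι : Type*} {w f h : ι → ℝ}
    (hw : ∀ i, 0 ≤ w i) (hfh : Monovary f h) (sw : Summable w)
    (sf : Summable fun i => w i * f i) (sh : Summable fun i => w i * h i)
    (sfh : Summable fun i => w i * (f i * h i)) :
    (∑' i, w i * f i) * ∑' i, w i * h i ≤ (∑' i, w i) * ∑' i, w i * (f i * h i) :=
  le_of_tendsto_of_tendsto' (Filter.Tendsto.mul sf.hasSum sh.hasSum)
    (Filter.Tendsto.mul sw.hasSum sfh.hasSum)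
    (sum_mul_sum_le_sum_mul_sum_of_monovary hw hfh)

theorem monotoneOn_div_add_rpow {x μ : ℝ} (hx : 0 ≤ x) (hμ : 0 ≤ μ) :
    MonotoneOn (fun b : ℝ => (b / (b + x)) ^ μ) (Set.Ioi 0) := by
  intro b hb c hc hbc
  rw [Set.mem_Ioi] at hb hc
  refine rpow_le_rpow (by positivity) ?_ hμ
  rw [div_le_div_iff₀ (by positivity) (by positivity)]
  nlinarith

theorem div_add_rpow_le_one {b x μ : ℝ} (hb : 0 < b) (hx : 0 ≤ x) (hμ : 0 ≤ μ) :
    (b / (b + x)) ^ μ ≤ 1 :=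
  rpow_le_one (by positivity) (div_le_one_of_le₀ (by linarith) (by positivity)) hμ

theorem div_add_rpow_mul_le {b x y μ : ℝ} (hb : 0 < b) (hx : 0 ≤ x) (hy : 0 ≤ y) (hμ : 0 ≤ μ) :
    (b / (b + x)) ^ μ * (b / (b + y)) ^ μ ≤ (b / (b + (x + y))) ^ μ := by
  rw [← mul_rpow (by positivity) (by positivity)]
  refine rpow_le_rpow (by positivity) ?_ hμ
  rw [div_mul_div_comm, div_le_div_iff₀ (by positivity) (by positivity)]
  nlinarith [mul_nonneg hb.le (mul_nonneg hx hy)]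

/-- Each term of the Mathieu series is a term of the auxiliary series times a damping factor. -/
theorem mathieu_term_eq {α β μ a x p q k : ℝ} (ha : 0 < a) (hx : 0 ≤ x) :
    2 * a ^ β * p * q / ((a ^ α + x) ^ μ * k) =
      2 * (p * q / (k * a ^ (α * μ - β)) * (a ^ α / (a ^ α + x)) ^ μ) := by
  have hb : 0 < a ^ α := rpow_pos_of_pos ha α
  have hbx : 0 < (a ^ α + x) ^ μ := by positivity
  have haβ : 0 < a ^ β := rpow_pos_of_pos ha β
  have haαμ : 0 < a ^ (α * μ) := rpow_pos_of_pos ha _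
  rw [div_rpow hb.le (by positivity), ← rpow_mul ha.le, rpow_sub ha]
  rcases eq_or_ne k 0 with rfl | hk
  · simp
  · field_simp

/-- For all `r₁, r₂ > 0`,
`S_{μ,ν}^{(α,β)}(√r₁, a; z) · S_{μ,ν}^{(α,β)}(√r₂, a; z)
  ≤ 2 ζ_{μ,ν}(α,β,z) · S_{μ,ν}^{(α,β)}(√(r₁+r₂), a; z)`,
where `ζ_{μ,ν}(α,β,z) = ∑_{n≥1} (ν)_n z^n / (n! a_n^{αμ-β})`. -/
theorem mathieu_supermultiplicative
    (α β μ ν z : ℝ) (a : ℕ+ → ℝ)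
    (hα : 0 < α) (hβ : 0 < β) (hμ : 0 < μ) (hν : 0 < ν)
    (hz0 : 0 ≤ z) (hz1 : z ≤ 1) (ha : ∀ n, 0 < a n)
    (hζ : Summable fun n : ℕ+ =>
      (ascPochhammer ℝ (n : ℕ)).eval ν * z ^ (n : ℕ) /
        (((n : ℕ).factorial : ℝ) * (a n) ^ (α * μ - β)))
    (g : ℝ → ℝ)
    (hg : ∀ x : ℝ, g x = ∑' n : ℕ+, 2 * (a n) ^ β * (ascPochhammer ℝ (n : ℕ)).eval ν *
        z ^ (n : ℕ) / (((a n) ^ α + x) ^ μ * ((n : ℕ).factorial : ℝ))) :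
    ∀ r₁ r₂ : ℝ, 0 < r₁ → 0 < r₂ →
      g r₁ * g r₂ ≤
        2 * (∑' n : ℕ+, (ascPochhammer ℝ (n : ℕ)).eval ν * z ^ (n : ℕ) /
            (((n : ℕ).factorial : ℝ) * (a n) ^ (α * μ - β))) * g (r₁ + r₂) := by
  intro r₁ r₂ hr₁ hr₂
  set w : ℕ+ → ℝ := fun n => (ascPochhammer ℝ (n : ℕ)).eval ν * z ^ (n : ℕ) /
    (((n : ℕ).factorial : ℝ) * (a n) ^ (α * μ - β))
  let f : ℝ → ℕ+ → ℝ := fun x n => (a n ^ α / (a n ^ α + x)) ^ μ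
  have hb : ∀ n, 0 < a n ^ α := fun n => rpow_pos_of_pos (ha n) α
  have hw : ∀ n, 0 ≤ w n := fun n => by
    have := ascPochhammer_pos (n : ℕ) ν hν
    have := ha n
    positivity
  have hf0 : ∀ x, 0 < x → ∀ n, 0 ≤ f x n := fun x hx n => by
    have := hb n
    positivity
  have hf1 : ∀ x, 0 < x → ∀ n, f x n ≤ 1 := fun x hx n =>
    div_add_rpow_le_one (hb n) hx.le hμ.le
  have hmono : ∀ x, 0 < x → ∀ i j, a i ^ α ≤ a j ^ α → f x i ≤ f x j := fun x hx i j =>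
    monotoneOn_div_add_rpow hx.le hμ.le (hb i) (hb j)
  have hmul : ∀ n, f r₁ n * f r₂ n ≤ f (r₁ + r₂) n := fun n =>
    div_add_rpow_mul_le (hb n) hr₁.le hr₂.le hμ.le
  have hvary : Monovary (f r₁) (f r₂) := fun i j hij =>
    hmono r₁ hr₁ i j (le_of_not_ge fun h => (hmono r₂ hr₂ j i h).not_gt hij)
  have hsum : ∀ x, 0 < x → Summable fun n => w n * f x n := fun x hx =>
    hζ.of_nonneg_of_le (fun n => mul_nonneg (hw n) (hf0 x hx n))
      fun n => mul_le_of_le_one_right (hw n) (hf1 x hx n)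
  have hr : 0 < r₁ + r₂ := add_pos hr₁ hr₂
  have hle : ∀ n, w n * (f r₁ n * f r₂ n) ≤ w n * f (r₁ + r₂) n := fun n =>
    mul_le_mul_of_nonneg_left (hmul n) (hw n)
  have hsum_mul : Summable fun n => w n * (f r₁ n * f r₂ n) :=
    (hsum _ hr).of_nonneg_of_le
      (fun n => mul_nonneg (hw n) (mul_nonneg (hf0 r₁ hr₁ n) (hf0 r₂ hr₂ n))) hle
  have hg_eq : ∀ x, 0 < x → g x = 2 * ∑' n, w n * f x n := fun x hx => by
    rw [hg, ← tsum_mul_left]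
    exact tsum_congr fun n => mathieu_term_eq (ha n) hx.le
  rw [hg_eq r₁ hr₁, hg_eq r₂ hr₂, hg_eq _ hr]
  have chebyshev := tsum_mul_tsum_le_tsum_mul_tsum_of_monovary hw hvary hζ
    (hsum r₁ hr₁) (hsum r₂ hr₂) hsum_mul
  have tsum_le := mul_le_mul_of_nonneg_left (hsum_mul.tsum_le_tsum hle (hsum _ hr))
    (show 0 ≤ ∑' n, w n from tsum_nonneg hw)
  linarith
end

section
/- Let α, β, μ, ν > 0, let 0 ≤ z ≤ 1, and let a = (a_n)_{n≥1} be a positive sequence such that both series ζ_{μ,ν}(α,β,z) = ∑_{n=1}^∞ (ν)_n z^n / (n! a_n^{αμ−β}) and ζ_{μ+1,ν}(α,β,z) = ∑_{n=1}^∞ (ν)_n z^n / (n! a_n^{α(μ+1)−β}) converge, with ζ_{μ,ν}(α,β,z) > 0. Then for every r > 0, S_{μ,ν}^{(α,β)}(r, a; z) ≥ 2 ζ_{μ,ν}(α,β,z) · exp(−μ r² ζ_{μ+1,ν}(α,β,z) / ζ_{μ,ν}(α,β,z)). -/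
open Real

/-- Jensen's inequality for the exponential and a countable family of nonnegative weights. -/
theorem tsum_mul_exp_neg_div_le_tsum {ι : Type*} {w x f : ι → ℝ} (hw : Summable w)
    (hwx : Summable fun i => w i * x i) (hf : Summable f) (hw0 : ∀ i, 0 ≤ w i)
    (hpos : 0 < ∑' i, w i) (hle : ∀ i, w i * exp (-x i) ≤ f i) :
    (∑' i, w i) * exp (-(∑' i, w i * x i) / ∑' i, w i) ≤ ∑' i, f i := by
  set c := (∑' i, w i * x i) / ∑' i, w i with hc
  have tangent (i : ι) : exp (-c) * ((1 + c) * w i - w i * x i) ≤ f i := by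
    refine le_trans ?_ (hle i)
    have hexp : exp (-x i) = exp (-c) * exp (c - x i) := by
      rw [← exp_add]; congr 1; ring
    have := mul_le_mul_of_nonneg_left (add_one_le_exp (c - x i))
      (mul_nonneg (hw0 i) (exp_pos (-c)).le)
    rw [hexp]
    linarith
  have hsum := (((hw.hasSum.mul_left (1 + c)).sub hwx.hasSum).mul_left (exp (-c)))
  have key := hasSum_le tangent hsum hf.hasSum
  have hcw : c * ∑' i, w i = ∑' i, w i * x i := div_mul_cancel₀ _ hpos.ne'
  rw [neg_div, ← hc]
  calc (∑' i, w i) * exp (-c)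
      = exp (-c) * ((1 + c) * ∑' i, w i - ∑' i, w i * x i) := by rw [← hcw]; ring
    _ ≤ ∑' i, f i := key

theorem rpow_add_sq_rpow_le_mul_exp {A α μ : ℝ} (hA : 0 < A) (hμ : 0 ≤ μ) (r : ℝ) :
    (A ^ α + r ^ 2) ^ μ ≤ A ^ (α * μ) * exp (μ * r ^ 2 / A ^ α) := by
  have hAα : 0 < A ^ α := rpow_pos_of_pos hA α
  calc (A ^ α + r ^ 2) ^ μ ≤ (A ^ α * exp (r ^ 2 / A ^ α)) ^ μ := by
        refine rpow_le_rpow (by positivity) ?_ hμ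
        calc A ^ α + r ^ 2 = A ^ α * (r ^ 2 / A ^ α + 1) := by field_simp; ring
          _ ≤ A ^ α * exp (r ^ 2 / A ^ α) := by gcongr; exact add_one_le_exp _
    _ = A ^ (α * μ) * exp (μ * r ^ 2 / A ^ α) := by
        rw [mul_rpow hAα.le (exp_pos _).le, ← rpow_mul hA.le, ← exp_mul]
        congr 2; ring

theorem rpow_mul_le_rpow_add_sq_rpow {A α μ : ℝ} (hA : 0 < A) (hμ : 0 ≤ μ) (r : ℝ) :
    A ^ (α * μ) ≤ (A ^ α + r ^ 2) ^ μ := by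
  rw [rpow_mul hA.le]
  exact rpow_le_rpow (rpow_nonneg hA.le α) (le_add_of_nonneg_right (sq_nonneg r)) hμ

/-- Exponential lower bound for the generalized Mathieu-type power series:
for every `r > 0`,
`S_{μ,ν}^{(α,β)}(r, a; z) ≥ 2 ζ_{μ,ν}(α,β,z) exp(−μ r² ζ_{μ+1,ν}(α,β,z)/ζ_{μ,ν}(α,β,z))`,
where `ζ_{μ,ν}(α,β,z) = ∑_{n≥1} (ν)_n z^n / (n! a_n^{αμ-β})`. -/
theorem mathieu_exponential_lower_bound
    (α β μ ν z : ℝ) (a : ℕ+ → ℝ)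
    (hα : 0 < α) (hβ : 0 < β) (hμ : 0 < μ) (hν : 0 < ν)
    (hz0 : 0 ≤ z) (hz1 : z ≤ 1) (ha : ∀ n, 0 < a n)
    (hζ : Summable fun n : ℕ+ =>
      (ascPochhammer ℝ (n : ℕ)).eval ν * z ^ (n : ℕ) /
        (((n : ℕ).factorial : ℝ) * (a n) ^ (α * μ - β)))
    (hζ' : Summable fun n : ℕ+ =>
      (ascPochhammer ℝ (n : ℕ)).eval ν * z ^ (n : ℕ) /
        (((n : ℕ).factorial : ℝ) * (a n) ^ (α * (μ + 1) - β)))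
    (ζμ ζμ' : ℝ)
    (hζμ : ζμ = ∑' n : ℕ+, (ascPochhammer ℝ (n : ℕ)).eval ν * z ^ (n : ℕ) /
        (((n : ℕ).factorial : ℝ) * (a n) ^ (α * μ - β)))
    (hζμ' : ζμ' = ∑' n : ℕ+, (ascPochhammer ℝ (n : ℕ)).eval ν * z ^ (n : ℕ) /
        (((n : ℕ).factorial : ℝ) * (a n) ^ (α * (μ + 1) - β)))
    (hζpos : 0 < ζμ) :
    ∀ r : ℝ, 0 < r →
      (∑' n : ℕ+, 2 * (a n) ^ β * (ascPochhammer ℝ (n : ℕ)).eval ν * z ^ (n : ℕ) /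
          (((a n) ^ α + r ^ 2) ^ μ * ((n : ℕ).factorial : ℝ))) ≥
        2 * ζμ * Real.exp (-μ * r ^ 2 * ζμ' / ζμ) := by
  intro r hr
  set w : ℕ+ → ℝ := fun n => (ascPochhammer ℝ (n : ℕ)).eval ν * z ^ (n : ℕ) /
    (((n : ℕ).factorial : ℝ) * (a n) ^ (α * μ - β)) with hw
  have hP (n : ℕ+) : 0 ≤ (ascPochhammer ℝ (n : ℕ)).eval ν * z ^ (n : ℕ) :=
    mul_nonneg (ascPochhammer_pos _ _ hν).le (pow_nonneg hz0 _)
  have hk (n : ℕ+) : (0 : ℝ) < ((n : ℕ).factorial : ℝ) := by positivity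
  have hw0 (n : ℕ+) : 0 ≤ w n :=
    div_nonneg (hP n) (mul_pos (hk n) (rpow_pos_of_pos (ha n) _)).le
  have hw' (n : ℕ+) : (ascPochhammer ℝ (n : ℕ)).eval ν * z ^ (n : ℕ) /
      (((n : ℕ).factorial : ℝ) * (a n) ^ (α * (μ + 1) - β)) = w n / (a n) ^ α := by
    rw [hw, show α * (μ + 1) - β = (α * μ - β) + α by ring, rpow_add (ha n), ← mul_assoc,
      div_div]
  have hpos (n : ℕ+) : 0 < ((a n) ^ α + r ^ 2) ^ μ :=
    (rpow_pos_of_pos (ha n) (α * μ)).trans_le (rpow_mul_le_rpow_add_sq_rpow (ha n) hμ.le r)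
  have hterm (n : ℕ+) : 2 * (a n) ^ β * (ascPochhammer ℝ (n : ℕ)).eval ν * z ^ (n : ℕ) /
      (((a n) ^ α + r ^ 2) ^ μ * ((n : ℕ).factorial : ℝ)) =
      2 * (w n * ((a n) ^ (α * μ) / ((a n) ^ α + r ^ 2) ^ μ)) := by
    have h1 := rpow_pos_of_pos (ha n) β
    have h2 := rpow_pos_of_pos (ha n) (α * μ)
    have h3 := hpos n
    have h4 := hk n
    simp only [hw]
    rw [rpow_sub (ha n)]
    field_simp
  simp only [hw'] at hζ' hζμ'
  have hwx (n : ℕ+) : w n * (μ * r ^ 2 / (a n) ^ α) = μ * r ^ 2 * (w n / (a n) ^ α) := by ring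
  have hf : Summable fun n => w n * ((a n) ^ (α * μ) / ((a n) ^ α + r ^ 2) ^ μ) := by
    refine hζ.of_nonneg_of_le
      (fun n => mul_nonneg (hw0 n) (div_nonneg (rpow_nonneg (ha n).le _) (hpos n).le))
      (fun n => mul_le_of_le_one_right (hw0 n) ?_)
    exact (div_le_one (hpos n)).2 (rpow_mul_le_rpow_add_sq_rpow (ha n) hμ.le r)
  have key := tsum_mul_exp_neg_div_le_tsum (x := fun n => μ * r ^ 2 / (a n) ^ α) hζ
    (by simpa only [hwx] using hζ'.mul_left (μ * r ^ 2)) hf hw0 (hζμ ▸ hζpos) fun n => by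
      refine mul_le_mul_of_nonneg_left ?_ (hw0 n)
      rw [exp_neg, le_div_iff₀ (hpos n), inv_mul_le_iff₀ (exp_pos _), mul_comm]
      exact rpow_add_sq_rpow_le_mul_exp (ha n) hμ.le r
  simp only [hwx, tsum_mul_left, ← hζμ, ← hζμ'] at key
  simp only [hterm, tsum_mul_left]
  rw [ge_iff_le, mul_assoc, neg_mul, neg_mul]
  exact mul_le_mul_of_nonneg_left key zero_le_two
end

section
/- Let μ > 1 and r > 0. Then the generalized Mathieu series satisfies S_μ(r) ≥ 2 ζ(2μ−1) · exp(−μ ζ(2μ+1) r² / ζ(2μ−1)), where ζ denotes the Riemann zeta function. -/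
open Real

/-- Jensen's inequality for the exponential function and a summable family of weights. -/
theorem tsum_mul_exp_le_tsum_mul_exp {ι : Type*} {w x : ι → ℝ} (hw : ∀ i, 0 ≤ w i)
    (hsw : Summable w) (hswx : Summable fun i ↦ w i * x i)
    (hswe : Summable fun i ↦ w i * exp (x i)) (hpos : 0 < ∑' i, w i) :
    (∑' i, w i) * exp ((∑' i, w i * x i) / ∑' i, w i) ≤ ∑' i, w i * exp (x i) := by
  set m := (∑' i, w i * x i) / ∑' i, w i
  have hmean : m * ∑' i, w i = ∑' i, w i * x i := div_mul_cancel₀ _ hpos.ne'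
  have hsum : HasSum (fun i ↦ exp m * ((1 - m) * w i + w i * x i))
      (exp m * ((1 - m) * (∑' i, w i) + ∑' i, w i * x i)) :=
    ((hsw.hasSum.mul_left _).add hswx.hasSum).mul_left _
  calc (∑' i, w i) * exp m = exp m * ((1 - m) * (∑' i, w i) + ∑' i, w i * x i) := by
        rw [← hmean]; ring
    _ ≤ ∑' i, w i * exp (x i) := hasSum_le (fun i ↦ ?_) hsum hswe.hasSum
  have htangent : exp m * (x i - m + 1) ≤ exp (x i) := by
    calc exp m * (x i - m + 1) ≤ exp m * exp (x i - m) := by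
          gcongr; exact add_one_le_exp _
      _ = exp (x i) := by rw [← exp_add]; ring_nf
  calc exp m * ((1 - m) * w i + w i * x i) = w i * (exp m * (x i - m + 1)) := by ring
    _ ≤ w i * exp (x i) := mul_le_mul_of_nonneg_left htangent (hw i)

theorem summable_pnat_one_div_rpow {p : ℝ} (hp : 1 < p) :
    Summable fun n : ℕ+ ↦ 1 / (n : ℝ) ^ p :=
  (summable_one_div_nat_rpow.mpr hp).comp_injective PNat.coe_injective

theorem one_div_rpow_mul_exp_le_mathieu_term {a μ : ℝ} (ha : 0 < a) (hμ : 0 ≤ μ) (r : ℝ) :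
    1 / a ^ (2 * μ - 1) * exp (-μ * r ^ 2 / a ^ 2) ≤ a / (a ^ 2 + r ^ 2) ^ μ := by
  have hsq : (a ^ 2) ^ μ = a ^ (2 * μ) := by
    rw [← rpow_natCast, ← rpow_mul ha.le, Nat.cast_ofNat]
  have hbase : a ^ 2 + r ^ 2 ≤ a ^ 2 * exp (r ^ 2 / a ^ 2) := by
    calc a ^ 2 + r ^ 2 = a ^ 2 * (r ^ 2 / a ^ 2 + 1) := by field_simp; ring
      _ ≤ a ^ 2 * exp (r ^ 2 / a ^ 2) := by gcongr; exact add_one_le_exp _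
  calc 1 / a ^ (2 * μ - 1) * exp (-μ * r ^ 2 / a ^ 2)
      = a / (a ^ 2 * exp (r ^ 2 / a ^ 2)) ^ μ := by
        rw [mul_rpow (by positivity) (exp_pos _).le, hsq, ← exp_mul, rpow_sub_one ha.ne',
          show -μ * r ^ 2 / a ^ 2 = -(r ^ 2 / a ^ 2 * μ) by ring, exp_neg]
        field_simp
    _ ≤ a / (a ^ 2 + r ^ 2) ^ μ := by gcongr

theorem mathieu_term_le_one_div_rpow {a μ : ℝ} (ha : 0 < a) (hμ : 0 ≤ μ) (r : ℝ) :
    a / (a ^ 2 + r ^ 2) ^ μ ≤ 1 / a ^ (2 * μ - 1) := by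
  have hsq : (a ^ 2) ^ μ = a ^ (2 * μ) := by
    rw [← rpow_natCast, ← rpow_mul ha.le, Nat.cast_ofNat]
  calc a / (a ^ 2 + r ^ 2) ^ μ ≤ a / (a ^ 2) ^ μ := by
        gcongr; exact le_add_of_nonneg_right (sq_nonneg r)
    _ = 1 / a ^ (2 * μ - 1) := by rw [hsq, rpow_sub_one ha.ne', one_div_div]

/-- For `μ > 1` and `r > 0`, the generalized Mathieu series
`S_μ(r) = ∑_{n≥1} 2n/(n²+r²)^μ` satisfies
`S_μ(r) ≥ 2 ζ(2μ-1) exp(−μ ζ(2μ+1) r² / ζ(2μ-1))`, where `ζ(p) = ∑_{n≥1} n^{-p}`. -/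
theorem mathieu_lower_bound_zeta
    (μ r : ℝ) (hμ : 1 < μ) (hr : 0 < r) :
    (∑' n : ℕ+, 2 * (n : ℝ) / ((n : ℝ) ^ 2 + r ^ 2) ^ μ) ≥
      2 * (∑' n : ℕ+, 1 / (n : ℝ) ^ (2 * μ - 1)) *
        Real.exp (-μ * (∑' n : ℕ+, 1 / (n : ℝ) ^ (2 * μ + 1)) * r ^ 2 /
          (∑' n : ℕ+, 1 / (n : ℝ) ^ (2 * μ - 1))) := by
  have hn (n : ℕ+) : (0 : ℝ) < n := mod_cast n.pos
  have hμ₀ : 0 ≤ μ := by linarith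
  have hweight : Summable fun n : ℕ+ ↦ 1 / (n : ℝ) ^ (2 * μ - 1) :=
    summable_pnat_one_div_rpow (by linarith)
  have hmathieu : Summable fun n : ℕ+ ↦ (n : ℝ) / ((n : ℝ) ^ 2 + r ^ 2) ^ μ :=
    hweight.of_nonneg_of_le (fun n ↦ by positivity)
      fun n ↦ mathieu_term_le_one_div_rpow (hn n) hμ₀ r
  have hexp : Summable fun n : ℕ+ ↦
      1 / (n : ℝ) ^ (2 * μ - 1) * exp (-μ * r ^ 2 / (n : ℝ) ^ 2) :=
    hmathieu.of_nonneg_of_le (fun n ↦ by positivity)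
      fun n ↦ one_div_rpow_mul_exp_le_mathieu_term (hn n) hμ₀ r
  have hmul (n : ℕ+) : 1 / (n : ℝ) ^ (2 * μ - 1) * (-μ * r ^ 2 / (n : ℝ) ^ 2) =
      -μ * r ^ 2 * (1 / (n : ℝ) ^ (2 * μ + 1)) := by
    rw [show 2 * μ + 1 = 2 * μ - 1 + (2 : ℕ) by push_cast; ring, rpow_add_natCast (hn n).ne']
    ring
  have hmean : Summable fun n : ℕ+ ↦
      1 / (n : ℝ) ^ (2 * μ - 1) * (-μ * r ^ 2 / (n : ℝ) ^ 2) := by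
    simp_rw [hmul]
    exact (summable_pnat_one_div_rpow (by linarith)).mul_left _
  have hpos : 0 < ∑' n : ℕ+, 1 / (n : ℝ) ^ (2 * μ - 1) :=
    hweight.tsum_pos (fun n ↦ by positivity) 1 (by simp)
  have hjensen := tsum_mul_exp_le_tsum_mul_exp (fun n ↦ by positivity) hweight hmean hexp hpos
  simp_rw [hmul, tsum_mul_left] at hjensen
  simp_rw [ge_iff_le, mul_div_assoc (2 : ℝ), tsum_mul_left, mul_assoc (2 : ℝ)]
  rw [mul_right_comm (-μ)]
  gcongr
  exact hjensen.trans (hexp.tsum_le_tsum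
    (fun n ↦ one_div_rpow_mul_exp_le_mathieu_term (hn n) hμ₀ r) hmathieu)
end

section
/- For every r > 0, the classical Mathieu series satisfies S(r) ≥ 2 ζ(3) · exp(−2 ζ(5) r² / ζ(3)), where ζ denotes the Riemann zeta function. -/
open Real

lemma summable_one_div_pnat_pow {p : ℕ} (hp : 1 < p) :
    Summable fun n : ℕ+ => 1 / (n : ℝ) ^ p :=
  (Real.summable_one_div_nat_pow.mpr hp).comp_injective PNat.coe_injective

lemma mathieu_term_ge_exp {x : ℝ} (hx : 0 < x) (r : ℝ) :
    2 * (1 / x ^ 3) * exp (-(2 * r ^ 2 / x ^ 2)) ≤ 2 * x / (x ^ 2 + r ^ 2) ^ 2 := by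
  have hsq : (1 + r ^ 2 / x ^ 2) ^ 2 ≤ exp (2 * r ^ 2 / x ^ 2) := by
    have h : 1 + r ^ 2 / x ^ 2 ≤ exp (r ^ 2 / x ^ 2) := by
      linarith [add_one_le_exp (r ^ 2 / x ^ 2)]
    calc (1 + r ^ 2 / x ^ 2) ^ 2 ≤ exp (r ^ 2 / x ^ 2) ^ 2 := by gcongr
      _ = exp (2 * r ^ 2 / x ^ 2) := by rw [← exp_nat_mul]; congr 1; push_cast; ring
  have heq : 2 * x / (x ^ 2 + r ^ 2) ^ 2 = 2 * (1 / x ^ 3) * ((1 + r ^ 2 / x ^ 2) ^ 2)⁻¹ := by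
    field_simp
  rw [heq, exp_neg]
  gcongr

/-- The tangent line of `exp` at `a` bounds each term of the Mathieu series from below. -/
lemma mathieu_term_ge_tangent {x : ℝ} (hx : 0 < x) (r a : ℝ) :
    2 * exp a * ((1 - a) * (1 / x ^ 3) - 2 * r ^ 2 * (1 / x ^ 5)) ≤
      2 * x / (x ^ 2 + r ^ 2) ^ 2 := by
  refine le_trans ?_ (mathieu_term_ge_exp hx r)
  have h : exp a * (1 - a - 2 * r ^ 2 / x ^ 2) ≤ exp (-(2 * r ^ 2 / x ^ 2)) := by
    calc exp a * (1 - a - 2 * r ^ 2 / x ^ 2)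
        ≤ exp a * exp (-(2 * r ^ 2 / x ^ 2) - a) := by
          gcongr
          linarith [add_one_le_exp (-(2 * r ^ 2 / x ^ 2) - a)]
      _ = exp (-(2 * r ^ 2 / x ^ 2)) := by rw [← exp_add]; ring_nf
  calc 2 * exp a * ((1 - a) * (1 / x ^ 3) - 2 * r ^ 2 * (1 / x ^ 5))
      = 2 * (1 / x ^ 3) * (exp a * (1 - a - 2 * r ^ 2 / x ^ 2)) := by field_simp
    _ ≤ 2 * (1 / x ^ 3) * exp (-(2 * r ^ 2 / x ^ 2)) := by gcongr

lemma summable_mathieu_s18 (r : ℝ) :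
    Summable fun n : ℕ+ => 2 * (n : ℝ) / ((n : ℝ) ^ 2 + r ^ 2) ^ 2 := by
  refine Summable.of_nonneg_of_le (fun n => by positivity) (fun n => ?_)
    ((summable_one_div_pnat_pow (p := 3) (by norm_num)).mul_left 2)
  have hn : (0 : ℝ) < n := by exact_mod_cast n.pos
  calc 2 * (n : ℝ) / ((n : ℝ) ^ 2 + r ^ 2) ^ 2 ≤ 2 * (n : ℝ) / ((n : ℝ) ^ 2) ^ 2 := by
        gcongr
        linarith [sq_nonneg r]
    _ = 2 * (1 / (n : ℝ) ^ 3) := by field_simp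

/-- For every `r > 0`, the classical Mathieu series
`S(r) = ∑_{n≥1} 2n/(n²+r²)²` satisfies `S(r) ≥ 2 ζ(3) exp(−2 ζ(5) r²/ζ(3))`,
where `ζ(p) = ∑_{n≥1} n^{-p}`. -/
theorem mathieu_lower_bound_zeta3
    (r : ℝ) (hr : 0 < r) :
    (∑' n : ℕ+, 2 * (n : ℝ) / ((n : ℝ) ^ 2 + r ^ 2) ^ 2) ≥
      2 * (∑' n : ℕ+, 1 / (n : ℝ) ^ 3) *
        Real.exp (-2 * (∑' n : ℕ+, 1 / (n : ℝ) ^ 5) * r ^ 2 /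
          (∑' n : ℕ+, 1 / (n : ℝ) ^ 3)) := by
  have h3 := summable_one_div_pnat_pow (p := 3) (by norm_num)
  have h5 := summable_one_div_pnat_pow (p := 5) (by norm_num)
  have hpos : 0 < ∑' n : ℕ+, 1 / (n : ℝ) ^ 3 :=
    h3.tsum_pos (fun n => by positivity) 1 (by norm_num)
  have htangent (a : ℝ) := ((h3.hasSum.mul_left (1 - a)).sub
    (h5.hasSum.mul_left (2 * r ^ 2))).mul_left (2 * exp a)
  have hle (a : ℝ) := hasSum_le
    (fun n : ℕ+ => mathieu_term_ge_tangent (x := (n : ℝ)) (by exact_mod_cast n.pos) r a)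
    (htangent a) (summable_mathieu_s18 r).hasSum
  generalize (∑' n : ℕ+, 1 / (n : ℝ) ^ 3) = z3 at *
  generalize (∑' n : ℕ+, 1 / (n : ℝ) ^ 5) = z5 at *
  refine le_of_eq_of_le ?_ (hle (-2 * z5 * r ^ 2 / z3))
  generalize hE : exp (-2 * z5 * r ^ 2 / z3) = E
  field_simp
  ring
end

section
/- For every r > 0, the generalized Mathieu series with exponent 3/2 satisfies S_{3/2}(r) ≥ (π²/3) · exp(−π² r² / 10). -/
open Real

lemma sq_add_sq_rpow_three_halves_le (r : ℝ) {n : ℝ} (hn : 0 < n) :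
    (n ^ 2 + r ^ 2) ^ ((3 : ℝ) / 2) ≤ n ^ 3 * exp (3 * r ^ 2 / (2 * n ^ 2)) := by
  have h : n ^ 2 + r ^ 2 ≤ n ^ 2 * exp (r ^ 2 / n ^ 2) := by
    calc n ^ 2 + r ^ 2 = n ^ 2 * (r ^ 2 / n ^ 2 + 1) := by field_simp; ring
      _ ≤ _ := by gcongr; exact add_one_le_exp _
  calc (n ^ 2 + r ^ 2) ^ ((3 : ℝ) / 2)
      ≤ (n ^ 2 * exp (r ^ 2 / n ^ 2)) ^ ((3 : ℝ) / 2) := by gcongr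
    _ = n ^ 3 * exp (3 * r ^ 2 / (2 * n ^ 2)) := by
      rw [mul_rpow (by positivity) (exp_pos _).le, ← exp_mul, ← rpow_natCast_mul hn.le,
        ← rpow_natCast n 3]
      congr 2
      · norm_num
      · field_simp

lemma cube_le_sq_add_sq_rpow_three_halves (r : ℝ) {n : ℝ} (hn : 0 ≤ n) :
    n ^ 3 ≤ (n ^ 2 + r ^ 2) ^ ((3 : ℝ) / 2) := by
  calc n ^ 3 = (n ^ 2) ^ ((3 : ℝ) / 2) := by
        rw [← rpow_natCast_mul hn, ← rpow_natCast n 3]; norm_num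
    _ ≤ _ := by gcongr; nlinarith [sq_nonneg r]

lemma mathieu_term_le (r : ℝ) {n : ℝ} (hn : 0 ≤ n) :
    2 * n / (n ^ 2 + r ^ 2) ^ ((3 : ℝ) / 2) ≤ 2 * (1 / n ^ 2) := by
  rcases hn.eq_or_lt with rfl | hn
  · simp
  calc _ ≤ 2 * n / n ^ 3 := by
        gcongr
        exact cube_le_sq_add_sq_rpow_three_halves r hn.le
    _ = _ := by field_simp

/-- Lower bound from the tangent line to `t ↦ exp (-t)` at `t = c`. -/
lemma le_mathieu_term (r c : ℝ) {n : ℝ} (hn : 0 ≤ n) :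
    exp (-c) * (2 * (1 + c) * (1 / n ^ 2) - 3 * r ^ 2 * (1 / n ^ 4)) ≤
      2 * n / (n ^ 2 + r ^ 2) ^ ((3 : ℝ) / 2) := by
  rcases hn.eq_or_lt with rfl | hn
  · simp
  set a := 3 * r ^ 2 / (2 * n ^ 2) with ha
  have hpos : 0 < (n ^ 2 + r ^ 2) ^ ((3 : ℝ) / 2) := by positivity
  calc exp (-c) * (2 * (1 + c) * (1 / n ^ 2) - 3 * r ^ 2 * (1 / n ^ 4))
      = 2 / n ^ 2 * (exp (-c) * (c - a + 1)) := by rw [ha]; field_simp; ring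
    _ ≤ 2 / n ^ 2 * (exp (-c) * exp (c - a)) := by gcongr; exact add_one_le_exp _
    _ = 2 * n / (n ^ 3 * exp a) := by
      rw [← exp_add, show -c + (c - a) = -a by ring, exp_neg]; field_simp
    _ ≤ _ := by
      gcongr
      exact sq_add_sq_rpow_three_halves_le r hn

/-- For every `r > 0`, the generalized Mathieu series with exponent `3/2`,
`S_{3/2}(r) = ∑_{n≥1} 2n/(n²+r²)^{3/2}`, satisfies
`S_{3/2}(r) ≥ (π²/3) exp(−π² r²/10)`. -/
theorem mathieu_lower_bound_three_halves
    (r : ℝ) (hr : 0 < r) :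
    (∑' n : ℕ+, 2 * (n : ℝ) / ((n : ℝ) ^ 2 + r ^ 2) ^ ((3 : ℝ) / 2)) ≥
      (π ^ 2 / 3) * Real.exp (-(π ^ 2) * r ^ 2 / 10) := by
  set c := π ^ 2 * r ^ 2 / 10 with hc
  have hsum : Summable fun n : ℕ ↦ 2 * (n : ℝ) / ((n : ℝ) ^ 2 + r ^ 2) ^ ((3 : ℝ) / 2) :=
    .of_nonneg_of_le (fun n ↦ by positivity) (fun n ↦ mathieu_term_le r n.cast_nonneg)
      (hasSum_zeta_two.summable.mul_left 2)
  rw [tsum_pnat_eq_tsum_of_eq_zero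
    (f := fun n : ℕ ↦ 2 * (n : ℝ) / ((n : ℝ) ^ 2 + r ^ 2) ^ ((3 : ℝ) / 2)) (by simp)]
  have hlow := ((hasSum_zeta_two.mul_left (2 * (1 + c))).sub
    (hasSum_zeta_four.mul_left (3 * r ^ 2))).mul_left (exp (-c))
  calc π ^ 2 / 3 * exp (-(π ^ 2) * r ^ 2 / 10)
      = exp (-c) * (2 * (1 + c) * (π ^ 2 / 6) - 3 * r ^ 2 * (π ^ 4 / 90)) := by
        rw [show -(π ^ 2) * r ^ 2 / 10 = -c by rw [hc]; ring,
          show 2 * (1 + c) * (π ^ 2 / 6) - 3 * r ^ 2 * (π ^ 4 / 90) = π ^ 2 / 3 by rw [hc]; ring,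
          mul_comm]
    _ ≤ _ := hasSum_le (fun n ↦ le_mathieu_term r c n.cast_nonneg) hlow hsum.hasSum
end
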